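/- arXiv:1801.09813 — 3 statements merged into one kernel-verified Lean document; each statement's English description precedes it below -/
import Mathlib

section
/- Let n ≥ 2, let u, v : {1,…,n} → ℝ, define Ψ(σ) = Σ_{j=1}^n u(j) v(σ_j) for σ ∈ S_n, and let X be a uniformly random element of S_n. Let ū = (1/n) Σ_j u(j), v̄ = (1/n) Σ_j v(j), and α = (max_j u(j) − min_j u(j)) (max_j v(j) − min_j v(j)). Then E Ψ(X) = n ū v̄, and E e^{Ψ(X)} = e^{E Ψ(X) + (1/2) Var Ψ(X) + L} for some L ∈ ℝ with |L| ≤ (3/2) n α³ + 11 n α⁴. -/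
open scoped BigOperators

namespace Stmt5

/-- Expectation of a real function of a uniformly random permutation of `Fin n`. -/
noncomputable def pExpR {n : ℕ} (g : Equiv.Perm (Fin n) → ℝ) : ℝ :=
  (∑ σ : Equiv.Perm (Fin n), g σ) / (Nat.factorial n : ℝ)

/-- Variance of a real function of a uniformly random permutation. -/
noncomputable def pVarR {n : ℕ} (g : Equiv.Perm (Fin n) → ℝ) : ℝ :=
  pExpR (fun σ => (g σ - pExpR g) ^ 2)

/-- Quantitative second-order expansion of the logarithmic moment generating function of a
centred variable `D + E` on a finite uniform space, where `E` is of the size of `D ^ 2`. -/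
lemma abs_log_mean_exp_sub_le {ι : Type*} [Fintype ι] [Nonempty ι] (D E : ι → ℝ) {α : ℝ}
    (hα : 0 ≤ α) (hD : ∀ i, |D i| ≤ α) (hE : ∀ i, |E i| ≤ 3 / 8 * α ^ 2)
    (hD0 : ∑ i, D i = 0) (hE0 : ∑ i, E i = 0) :
    |Real.log ((∑ i, Real.exp (D i + E i)) / Fintype.card ι)
        - (1 / 2) * ((∑ i, D i ^ 2) / Fintype.card ι)|
      ≤ 3 / 2 * α ^ 3 + 11 * α ^ 4 := by
  have hN : (0 : ℝ) < Fintype.card ι := by exact_mod_cast Fintype.card_pos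
  obtain ⟨N, hNdef⟩ : ∃ N : ℝ, N = Fintype.card ι := ⟨_, rfl⟩
  rw [← hNdef] at hN ⊢
  have hB : ∀ i, |D i + E i| ≤ α + 3 / 8 * α ^ 2 := fun i =>
    (abs_add_le _ _).trans (add_le_add (hD i) (hE i))
  set p := (∑ i, Real.exp (D i + E i)) / N with hp
  set d := (∑ i, D i ^ 2) / N with hd
  have hp1 : 1 ≤ p := by
    rw [hp, le_div_iff₀ hN]
    have : ∑ i, (D i + E i + 1) ≤ ∑ i, Real.exp (D i + E i) :=
      Finset.sum_le_sum fun i _ => Real.add_one_le_exp _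
    rw [Finset.sum_add_distrib, Finset.sum_add_distrib, hD0, hE0] at this
    simpa [hNdef] using this
  have hp0 : 0 < p := by linarith
  have hd0 : 0 ≤ d := div_nonneg (Finset.sum_nonneg fun i _ => sq_nonneg _) hN.le
  have hdα : d ≤ α ^ 2 := by
    rw [hd, div_le_iff₀ hN]
    have : ∑ i, D i ^ 2 ≤ ∑ _i : ι, α ^ 2 :=
      Finset.sum_le_sum fun i _ => sq_le_sq' (by linarith [(abs_le.1 (hD i)).1])
        (abs_le.1 (hD i)).2
    simpa [hNdef, mul_comm] using this
  have hlog0 : 0 ≤ Real.log p := Real.log_nonneg hp1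
  rcases le_or_gt α (1 / 2) with hs | hl
  · set B := α + 3 / 8 * α ^ 2 with hBdef
    have hB19 : B ≤ 19 / 16 * α := by nlinarith
    have hB0 : 0 ≤ B := by positivity
    have hB3 : B ^ 3 ≤ 27 / 16 * α ^ 3 := by
      have h1 := pow_le_pow_left₀ hB0 hB19 3
      have h2 : 0 ≤ α ^ 3 := by positivity
      rw [mul_pow] at h1
      linarith
    set K := 4 / 5 * α ^ 3 with hK
    have hpt : ∀ i, |Real.exp (D i + E i) - 1 - (D i + E i) - D i ^ 2 / 2| ≤ K := by
      intro i
      have hY1 : |D i + E i| ≤ 1 := (hB i).trans (by linarith)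
      have h1 := Real.exp_bound hY1 (n := 3) (by norm_num)
      have h3 : |D i + E i| ^ 3 ≤ B ^ 3 := pow_le_pow_left₀ (abs_nonneg _) (hB i) 3
      norm_num [Finset.sum_range_succ, Nat.factorial] at h1
      have h2 : |D i * E i| ≤ α * (3 / 8 * α ^ 2) := by
        rw [abs_mul]; exact mul_le_mul (hD i) (hE i) (abs_nonneg _) hα
      have h4 : E i ^ 2 ≤ (3 / 8 * α ^ 2) ^ 2 := by
        rw [← sq_abs]; exact pow_le_pow_left₀ (abs_nonneg _) (hE i) 2
      have h5 : 0 ≤ E i ^ 2 := sq_nonneg _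
      have h6 : α ^ 4 ≤ 1 / 2 * α ^ 3 := by
        have : 0 ≤ α ^ 3 := by positivity
        nlinarith
      have h7 : 0 ≤ α ^ 3 := by positivity
      rw [abs_le] at h1 h2 ⊢
      constructor <;> nlinarith
    have hr : |p - 1 - 1 / 2 * d| ≤ K := by
      have e : p - 1 - 1 / 2 * d
          = (∑ i, (Real.exp (D i + E i) - 1 - (D i + E i) - D i ^ 2 / 2)) / N := by
        simp only [Finset.sum_sub_distrib, Finset.sum_add_distrib, hD0, hE0, ← Finset.sum_div]
        simp only [Finset.sum_const, Finset.card_univ, nsmul_eq_mul, ← hNdef]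
        rw [hp, hd]
        field_simp
        ring
      rw [e, abs_div, abs_of_pos hN, div_le_iff₀ hN]
      refine (Finset.abs_sum_le_sum_abs _ _).trans ((Finset.sum_le_sum fun i _ => hpt i).trans ?_)
      simp [hNdef, mul_comm]
    have hup : Real.log p ≤ p - 1 := Real.log_le_sub_one_of_pos hp0
    have hlow : p - 1 - (p - 1) ^ 2 ≤ Real.log p := by
      refine le_trans ?_ (Real.one_sub_inv_le_log_of_pos hp0)
      have : 1 - p⁻¹ - (p - 1 - (p - 1) ^ 2) = (p - 1) ^ 3 / p := by
        field_simp
        ring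
      have h3 : 0 ≤ (p - 1) ^ 3 / p := div_nonneg (pow_nonneg (by linarith) 3) hp0.le
      linarith
    have hKα : K ≤ 1 / 2 * α ^ 2 := by
      have : 0 ≤ α ^ 2 := by positivity
      rw [hK]; nlinarith
    have hx : p - 1 ≤ α ^ 2 := by linarith [(abs_le.1 hr).2]
    have hx2 : (p - 1) ^ 2 ≤ α ^ 4 := by
      calc (p - 1) ^ 2 ≤ (α ^ 2) ^ 2 := pow_le_pow_left₀ (by linarith) hx 2
        _ = α ^ 4 := by ring
    have h7 : 0 ≤ α ^ 3 := by positivity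
    have h8 : 0 ≤ α ^ 4 := by positivity
    rw [abs_le] at hr ⊢
    constructor <;> linarith
  · have hpB : p ≤ Real.exp (α + 3 / 8 * α ^ 2) := by
      rw [hp, div_le_iff₀ hN]
      refine (Finset.sum_le_sum fun i _ =>
        Real.exp_le_exp.2 ((le_abs_self _).trans (hB i))).trans ?_
      simp [hNdef, mul_comm]
    have hup : Real.log p ≤ α + 3 / 8 * α ^ 2 := by
      rw [← Real.log_exp (α + 3 / 8 * α ^ 2)]
      exact Real.log_le_log hp0 hpB
    have h2 : 1 / 4 ≤ α ^ 2 := by nlinarith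
    have h4 : 1 / 4 * α ^ 2 ≤ α ^ 4 := by nlinarith
    have h3 : 0 ≤ α ^ 3 := by positivity
    have h1 : 1 / 2 * α ≤ α ^ 2 := by nlinarith
    rw [abs_le]
    constructor <;> linarith

/-- The centred sum of squares `∑ (u j - ū) ^ 2`, in expanded form. -/
noncomputable def centredSq {n : ℕ} (u : Fin n → ℝ) : ℝ :=
  ∑ j, u j ^ 2 - (∑ j, u j) ^ 2 / n

/-- The variance of the linear permutation statistic. -/
noncomputable def linVar {n : ℕ} (u v : Fin n → ℝ) : ℝ :=
  centredSq u * centredSq v / ((n : ℝ) - 1)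

/-- The mean of the linear permutation statistic. -/
noncomputable def linMean {n : ℕ} (u v : Fin n → ℝ) : ℝ :=
  (∑ j, u j) * (∑ j, v j) / n

/-- The values of `v` with the one at `p` removed. -/
def removeAt {n : ℕ} (v : Fin (n + 1) → ℝ) (p : Fin (n + 1)) (k : Fin n) : ℝ :=
  v (Equiv.swap 0 p k.succ)

lemma sum_removeAt {n : ℕ} (v : Fin (n + 1) → ℝ) (p : Fin (n + 1)) (F : ℝ → ℝ) :
    ∑ k, F (removeAt v p k) = ∑ j, F (v j) - F (v p) := by
  rw [← Equiv.sum_comp (Equiv.swap 0 p) (fun j => F (v j)), Fin.sum_univ_succ]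
  simp [removeAt]

/-- Conditioning a linear permutation statistic on the image of `0`. -/
lemma pExpR_succ {n : ℕ} (u v : Fin (n + 1) → ℝ) (g : ℝ → ℝ) :
    pExpR (fun σ : Equiv.Perm (Fin (n + 1)) => g (∑ j, u j * v (σ j))) =
      (∑ p, pExpR (fun σ : Equiv.Perm (Fin n) =>
        g (u 0 * v p + ∑ j, u j.succ * removeAt v p (σ j)))) / ((n : ℝ) + 1) := by
  unfold pExpR
  rw [← Equiv.sum_comp Equiv.Perm.decomposeFin.symm, Fintype.sum_prod_type, ← Finset.sum_div,
    Nat.factorial_succ, div_div]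
  push_cast
  rw [mul_comm ((n : ℝ) + 1)]
  simp [Fin.sum_univ_succ, removeAt, Equiv.Perm.decomposeFin_symm_apply_succ]

lemma pExpR_add {n : ℕ} (f g : Equiv.Perm (Fin n) → ℝ) :
    pExpR (fun σ => f σ + g σ) = pExpR f + pExpR g := by
  simp [pExpR, Finset.sum_add_distrib, add_div]

lemma pExpR_const_mul {n : ℕ} (c : ℝ) (f : Equiv.Perm (Fin n) → ℝ) :
    pExpR (fun σ => c * f σ) = c * pExpR f := by
  simp [pExpR, ← Finset.mul_sum, mul_div_assoc]

lemma pExpR_const {n : ℕ} (c : ℝ) : pExpR (fun _ : Equiv.Perm (Fin n) => c) = c := by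
  have : (n.factorial : ℝ) ≠ 0 := by positivity
  simp [pExpR, Fintype.card_perm]
  field_simp

lemma centredSq_removeAt {n : ℕ} (hn : 0 < n) (v : Fin (n + 1) → ℝ) (p : Fin (n + 1)) :
    centredSq (removeAt v p) = centredSq v
      - ((n : ℝ) + 1) / n * (v p - (∑ j, v j) / ((n : ℝ) + 1)) ^ 2 := by
  have h0 : (n : ℝ) ≠ 0 := by positivity
  have h1 : (n : ℝ) + 1 ≠ 0 := by positivity
  have e1 := sum_removeAt v p (fun x => x)
  have e2 := sum_removeAt v p (fun x => x ^ 2)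
  rw [centredSq, centredSq, e1, e2]
  push_cast
  field_simp
  ring

lemma centredSq_succ {n : ℕ} (hn : 0 < n) (u : Fin (n + 1) → ℝ) :
    centredSq u = centredSq (fun j : Fin n => u j.succ)
      + (n : ℝ) / (n + 1) * (u 0 - (∑ j : Fin n, u j.succ) / n) ^ 2 := by
  have h0 : (n : ℝ) ≠ 0 := by positivity
  have h1 : (n : ℝ) + 1 ≠ 0 := by positivity
  rw [centredSq, centredSq, Fin.sum_univ_succ, Fin.sum_univ_succ]
  push_cast
  field_simp
  ring

lemma linMean_removeAt {n : ℕ} (hn : 0 < n) (u v : Fin (n + 1) → ℝ) (p : Fin (n + 1)) :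
    u 0 * v p + linMean (fun j : Fin n => u j.succ) (removeAt v p) = linMean u v
      + (u 0 - (∑ j : Fin n, u j.succ) / n) * (v p - (∑ j, v j) / ((n : ℝ) + 1)) := by
  have h0 : (n : ℝ) ≠ 0 := by positivity
  have h1 : (n : ℝ) + 1 ≠ 0 := by positivity
  have e1 := sum_removeAt v p (fun x => x)
  rw [linMean, linMean, e1, Fin.sum_univ_succ (f := u)]
  push_cast
  field_simp
  ring

lemma sum_sub_mean {n : ℕ} (v : Fin (n + 1) → ℝ) :
    ∑ p, (v p - (∑ j, v j) / ((n : ℝ) + 1)) = 0 := by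
  have h1 : (n : ℝ) + 1 ≠ 0 := by positivity
  simp [Finset.sum_sub_distrib]
  field_simp
  ring

lemma sum_sub_mean_sq {n : ℕ} (v : Fin (n + 1) → ℝ) :
    ∑ p, (v p - (∑ j, v j) / ((n : ℝ) + 1)) ^ 2 = centredSq v := by
  have h1 : (n : ℝ) + 1 ≠ 0 := by positivity
  simp only [sub_sq, Finset.sum_sub_distrib, Finset.sum_add_distrib, ← Finset.sum_mul,
    ← Finset.mul_sum, centredSq]
  simp
  field_simp
  ring

lemma centredSq_fin_one (u : Fin 1 → ℝ) : centredSq u = 0 := by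
  simp [centredSq]

/-- The conditional variance given the image of `0`, split into its mean and a fluctuation. -/
lemma linVar_removeAt {n : ℕ} (hn : 0 < n) (u v : Fin (n + 1) → ℝ) (p : Fin (n + 1)) :
    linVar (fun j : Fin n => u j.succ) (removeAt v p) =
      centredSq (fun j : Fin n => u j.succ) * centredSq v / n
      + centredSq (fun j : Fin n => u j.succ) * ((n : ℝ) + 1) / (n * (n - 1)) *
        (centredSq v / (n + 1) - (v p - (∑ j, v j) / ((n : ℝ) + 1)) ^ 2) := by
  have h0 : (n : ℝ) ≠ 0 := by positivity
  have h1 : (n : ℝ) + 1 ≠ 0 := by positivity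
  rw [linVar, centredSq_removeAt hn]
  obtain rfl | h2 : n = 1 ∨ 1 < n := by omega
  · simp [centredSq_fin_one]
  · have h3 : (n : ℝ) - 1 ≠ 0 := by
      have : (1 : ℝ) < n := by exact_mod_cast h2
      linarith
    field_simp
    ring

/-- Law of total variance for the linear permutation statistic. -/
lemma linVar_succ {n : ℕ} (hn : 0 < n) (u v : Fin (n + 1) → ℝ) :
    linVar u v = centredSq (fun j : Fin n => u j.succ) * centredSq v / n
      + (∑ p, ((u 0 - (∑ j : Fin n, u j.succ) / n) *
          (v p - (∑ j, v j) / ((n : ℝ) + 1))) ^ 2) / ((n : ℝ) + 1) := by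
  have h0 : (n : ℝ) ≠ 0 := by positivity
  have h1 : (n : ℝ) + 1 ≠ 0 := by positivity
  simp only [mul_pow, ← Finset.mul_sum]
  rw [sum_sub_mean_sq, linVar, centredSq_succ hn u]
  push_cast
  rw [add_sub_cancel_right]
  field_simp

lemma sum_centredSq_sub {n : ℕ} (v : Fin (n + 1) → ℝ) :
    ∑ p, (centredSq v / ((n : ℝ) + 1) - (v p - (∑ j, v j) / ((n : ℝ) + 1)) ^ 2) = 0 := by
  have h1 : (n : ℝ) + 1 ≠ 0 := by positivity
  rw [Finset.sum_sub_distrib, sum_sub_mean_sq]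
  simp
  field_simp
  ring

lemma pExpR_linear {n : ℕ} (hn : 0 < n) (u v : Fin n → ℝ) :
    pExpR (fun σ : Equiv.Perm (Fin n) => ∑ j, u j * v (σ j)) = linMean u v := by
  induction n, hn using Nat.le_induction with
  | base => simp [pExpR, linMean]
  | succ n hn ih =>
    rw [pExpR_succ u v (fun x => x)]
    simp only [pExpR_add, pExpR_const, ih, linMean_removeAt hn, Finset.sum_add_distrib,
      ← Finset.mul_sum, sum_sub_mean]
    have h1 : (n : ℝ) + 1 ≠ 0 := by positivity
    simp
    field_simp

lemma pExpR_sq_sub_linMean {n : ℕ} (hn : 0 < n) (u v : Fin n → ℝ) :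
    pExpR (fun σ : Equiv.Perm (Fin n) => (∑ j, u j * v (σ j) - linMean u v) ^ 2)
      = linVar u v := by
  induction n, hn using Nat.le_induction with
  | base => simp [pExpR, linMean, linVar]
  | succ n hn ih =>
    have h1 : (n : ℝ) + 1 ≠ 0 := by positivity
    rw [pExpR_succ u v (fun x => (x - linMean u v) ^ 2), linVar_succ hn]
    have key : ∀ p, pExpR (fun σ : Equiv.Perm (Fin n) =>
        (u 0 * v p + ∑ j, u j.succ * removeAt v p (σ j) - linMean u v) ^ 2)
        = linVar (fun j : Fin n => u j.succ) (removeAt v p) +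
          ((u 0 - (∑ j : Fin n, u j.succ) / n) * (v p - (∑ j, v j) / ((n : ℝ) + 1))) ^ 2 := by
      intro p
      have hm := linMean_removeAt hn u v p
      set m := linMean (fun j : Fin n => u j.succ) (removeAt v p) with hmdef
      set d := (u 0 - (∑ j : Fin n, u j.succ) / n) * (v p - (∑ j, v j) / ((n : ℝ) + 1))
      have e : ∀ σ : Equiv.Perm (Fin n),
          (u 0 * v p + ∑ j, u j.succ * removeAt v p (σ j) - linMean u v) ^ 2
          = (∑ j, u j.succ * removeAt v p (σ j) - m) ^ 2
            + (2 * d * ∑ j, u j.succ * removeAt v p (σ j) + (d ^ 2 - 2 * d * m)) := by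
        intro σ
        rw [show linMean u v = u 0 * v p + m - d by linarith]
        ring
      simp only [e, pExpR_add, pExpR_const, pExpR_const_mul]
      rw [ih, pExpR_linear hn, ← hmdef]
      ring
    simp only [key, linVar_removeAt hn, Finset.sum_add_distrib, ← Finset.mul_sum,
      sum_centredSq_sub]
    simp
    field_simp

lemma centredSq_nonneg {n : ℕ} (u : Fin n → ℝ) : 0 ≤ centredSq u := by
  cases n with
  | zero => simp [centredSq]
  | succ n => rw [← sum_sub_mean_sq]; exact Finset.sum_nonneg fun i _ => sq_nonneg _

/-- Popoviciu's inequality. -/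
lemma centredSq_le {n : ℕ} (hn : 0 < n) (u : Fin n → ℝ) {l a : ℝ}
    (hu : ∀ j, l ≤ u j ∧ u j ≤ l + a) : centredSq u ≤ n * a ^ 2 / 4 := by
  have h0 : (0 : ℝ) < n := by positivity
  have h : 0 ≤ ∑ j, (u j - l) * (l + a - u j) :=
    Finset.sum_nonneg fun j _ => mul_nonneg (by linarith [hu j]) (by linarith [hu j])
  have e : ∑ j, (u j - l) * (l + a - u j)
      = (2 * l + a) * ∑ j, u j - ∑ j, u j ^ 2 - n * (l * (l + a)) := by
    have : ∀ j, (u j - l) * (l + a - u j) = (2 * l + a) * u j - u j ^ 2 - l * (l + a) :=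
      fun j => by ring
    simp [this, Finset.sum_sub_distrib, Finset.mul_sum]
  have e2 : n * a ^ 2 / 4 - centredSq u = ∑ j, (u j - l) * (l + a - u j)
      + ((∑ j, u j) - n * (l + a / 2)) ^ 2 / n := by
    rw [e, centredSq]
    field_simp
    ring
  have : 0 ≤ ((∑ j, u j) - n * (l + a / 2)) ^ 2 / n := by positivity
  linarith

lemma mean_mem {n : ℕ} (hn : 0 < n) (u : Fin n → ℝ) {l a : ℝ}
    (hu : ∀ j, l ≤ u j ∧ u j ≤ l + a) :
    l ≤ (∑ j, u j) / n ∧ (∑ j, u j) / n ≤ l + a := by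
  have h0 : (0 : ℝ) < n := by positivity
  rw [le_div_iff₀ h0, div_le_iff₀ h0]
  constructor
  · simpa [mul_comm] using Finset.sum_le_sum fun j (_ : j ∈ Finset.univ) => (hu j).1
  · refine (Finset.sum_le_sum fun j _ => (hu j).2).trans (le_of_eq ?_)
    rw [Finset.sum_const, Finset.card_univ, Fintype.card_fin, nsmul_eq_mul, mul_comm]

lemma pExpR_exp_pos {n : ℕ} (f : Equiv.Perm (Fin n) → ℝ) :
    0 < pExpR (fun σ => Real.exp (f σ)) :=
  div_pos (Finset.sum_pos (fun _ _ => Real.exp_pos _) Finset.univ_nonempty) (by positivity)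

lemma abs_log_pExpR_exp_sub_le {n : ℕ} (hn : 0 < n) (u v : Fin n → ℝ) {l a m b : ℝ}
    (hu : ∀ j, l ≤ u j ∧ u j ≤ l + a) (hv : ∀ j, m ≤ v j ∧ v j ≤ m + b) :
    |Real.log (pExpR (fun σ : Equiv.Perm (Fin n) => Real.exp (∑ j, u j * v (σ j))))
      - linMean u v - 1 / 2 * linVar u v| ≤ n * (3 / 2 * (a * b) ^ 3 + 11 * (a * b) ^ 4) := by
  induction n, hn using Nat.le_induction with
  | base =>
    have ha : 0 ≤ a := by linarith [hu 0]
    have hb : 0 ≤ b := by linarith [hv 0]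
    simp [pExpR, linMean, linVar, centredSq_fin_one]
    positivity
  | succ n hn ih =>
    have ha : 0 ≤ a := by linarith [hu 0]
    have hb : 0 ≤ b := by linarith [hv 0]
    have hn0 : (0 : ℝ) < n := by positivity
    have h1 : (0 : ℝ) < n + 1 := by positivity
    set C := 3 / 2 * (a * b) ^ 3 + 11 * (a * b) ^ 4 with hC
    set u' := fun j : Fin n => u j.succ with hu'
    have hu'b : ∀ j, l ≤ u' j ∧ u' j ≤ l + a := fun j => hu j.succ
    set D := fun p => (u 0 - (∑ j : Fin n, u j.succ) / n) *
      (v p - (∑ j, v j) / ((n : ℝ) + 1)) with hD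
    set E := fun p => 1 / 2 * (centredSq u' * ((n : ℝ) + 1) / (n * (n - 1)) *
        (centredSq v / (n + 1) - (v p - (∑ j, v j) / ((n : ℝ) + 1)) ^ 2)) with hE
    have hw : ∀ p, |v p - (∑ j, v j) / ((n : ℝ) + 1)| ≤ b := by
      intro p
      have := mean_mem n.succ_pos v hv
      push_cast at this
      rw [abs_le]
      constructor <;> linarith [hv p]
    have hDα : ∀ p, |D p| ≤ a * b := by
      intro p
      have := mean_mem hn u' hu'b
      rw [hD, abs_mul]
      refine mul_le_mul ?_ (hw p) (abs_nonneg _) ha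
      rw [abs_le]
      constructor <;> linarith [hu 0]
    have hEα : ∀ p, |E p| ≤ 3 / 8 * (a * b) ^ 2 := by
      intro p
      obtain rfl | h2 : n = 1 ∨ 2 ≤ n := by omega
      · simp [hE, centredSq_fin_one]
        positivity
      · have h2' : (2 : ℝ) ≤ n := by exact_mod_cast h2
        have hs0 := centredSq_nonneg u'
        have hs := centredSq_le hn u' hu'b
        have ht0 := centredSq_nonneg v
        have ht := centredSq_le n.succ_pos v hv
        push_cast at ht
        have hc : centredSq u' * ((n : ℝ) + 1) / (n * (n - 1)) ≤ 3 / 4 * a ^ 2 := by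
          rw [div_le_iff₀ (by nlinarith)]
          have h3 : (n : ℝ) + 1 ≤ 3 * (n - 1) := by linarith
          calc centredSq u' * ((n : ℝ) + 1) ≤ (n * a ^ 2 / 4) * (3 * (n - 1)) :=
                mul_le_mul hs h3 h1.le (by positivity)
            _ = _ := by ring
        have hc0 : 0 ≤ centredSq u' * ((n : ℝ) + 1) / (n * (n - 1)) :=
          div_nonneg (by positivity) (by nlinarith)
        have hf : |centredSq v / (n + 1) - (v p - (∑ j, v j) / ((n : ℝ) + 1)) ^ 2| ≤ b ^ 2 := by
          have g1 : 0 ≤ centredSq v / ((n : ℝ) + 1) := by positivity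
          have g2 : centredSq v / ((n : ℝ) + 1) ≤ b ^ 2 / 4 := by
            rw [div_le_iff₀ h1]; linarith
          have g3 := pow_le_pow_left₀ (abs_nonneg _) (hw p) 2
          rw [sq_abs] at g3
          have g4 := sq_nonneg (v p - (∑ j, v j) / ((n : ℝ) + 1))
          have g5 := sq_nonneg b
          rw [abs_le]
          constructor <;> linarith
        simp only [hE]
        rw [abs_mul, abs_mul, abs_of_nonneg hc0, abs_of_pos (by norm_num : (0 : ℝ) < 1 / 2)]
        have := mul_le_mul hc hf (abs_nonneg _) (by positivity)
        nlinarith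
    have hD0 : ∑ p, D p = 0 := by simp only [hD, ← Finset.mul_sum, sum_sub_mean, mul_zero]
    have hE0 : ∑ p, E p = 0 := by
      simp only [hE, ← Finset.mul_sum, sum_centredSq_sub, mul_zero]
    have hmain := abs_log_mean_exp_sub_le D E (mul_nonneg ha hb) hDα hEα hD0 hE0
    rw [Fintype.card_fin] at hmain
    push_cast at hmain
    rw [← hC] at hmain
    set A := linMean u v + 1 / 2 * (centredSq u' * centredSq v / n) with hA
    have hvar : linMean u v + 1 / 2 * linVar u v
        = A + 1 / 2 * ((∑ p, D p ^ 2) / ((n : ℝ) + 1)) := by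
      rw [linVar_succ hn]; ring
    have hcond : ∀ p,
        |Real.log (pExpR (fun σ : Equiv.Perm (Fin n) =>
          Real.exp (u 0 * v p + ∑ j, u j.succ * removeAt v p (σ j)))) - (A + (D p + E p))|
          ≤ n * C := by
      intro p
      have hi := ih u' (removeAt v p) hu'b (fun k => hv _)
      simp only [Real.exp_add, pExpR_const_mul]
      rw [Real.log_mul (Real.exp_pos _).ne' (pExpR_exp_pos _).ne', Real.log_exp]
      have e1 := linMean_removeAt hn u v p
      have e2 := linVar_removeAt hn u v p
      convert hi using 2
      simp only [hA, hD, hE]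
      linarith
    set G := fun p => pExpR (fun σ : Equiv.Perm (Fin n) =>
          Real.exp (u 0 * v p + ∑ j, u j.succ * removeAt v p (σ j))) with hG
    have hG0 : ∀ p, 0 < G p := fun p => pExpR_exp_pos _
    set P := (∑ p, Real.exp (D p + E p)) / ((n : ℝ) + 1) with hP
    have hP0 : 0 < P :=
      div_pos (Finset.sum_pos (fun _ _ => Real.exp_pos _) Finset.univ_nonempty) h1
    have hsum : ∀ c, (∑ p, Real.exp (A + (D p + E p) + c)) / ((n : ℝ) + 1)
        = Real.exp (A + c) * P := by
      intro c
      rw [hP, ← mul_div_assoc, Finset.mul_sum]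
      congr 1
      refine Finset.sum_congr rfl fun p _ => ?_
      rw [← Real.exp_add]
      ring_nf
    rw [pExpR_succ u v Real.exp]
    have hup : (∑ p, G p) / ((n : ℝ) + 1) ≤ Real.exp (A + n * C) * P := by
      rw [← hsum]
      refine div_le_div_of_nonneg_right (Finset.sum_le_sum fun p _ => ?_) h1.le
      rw [← Real.log_le_iff_le_exp (hG0 p)]
      linarith [(abs_le.1 (hcond p)).2]
    have hlow : Real.exp (A + -(n * C)) * P ≤ (∑ p, G p) / ((n : ℝ) + 1) := by
      rw [← hsum]
      refine div_le_div_of_nonneg_right (Finset.sum_le_sum fun p _ => ?_) h1.le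
      rw [← Real.le_log_iff_exp_le (hG0 p)]
      linarith [(abs_le.1 (hcond p)).1]
    have hS0 : 0 < (∑ p, G p) / ((n : ℝ) + 1) := lt_of_lt_of_le (by positivity) hlow
    have hup' := Real.log_le_log hS0 hup
    have hlow' := Real.log_le_log (by positivity) hlow
    rw [Real.log_mul (Real.exp_pos _).ne' hP0.ne', Real.log_exp] at hup' hlow'
    rw [sub_sub, hvar]
    push_cast
    rw [abs_le] at hmain ⊢
    constructor <;> linarith

theorem statement5 (n : ℕ) (hn : 2 ≤ n) (u v : Fin n → ℝ) :
    pExpR (fun σ : Equiv.Perm (Fin n) => ∑ j, u j * v (σ j)) =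
      n * ((∑ j, u j) / n) * ((∑ j, v j) / n) ∧
    ∃ L : ℝ,
      pExpR (fun σ : Equiv.Perm (Fin n) => Real.exp (∑ j, u j * v (σ j))) =
        Real.exp (pExpR (fun σ : Equiv.Perm (Fin n) => ∑ j, u j * v (σ j)) +
          (1 / 2) * pVarR (fun σ : Equiv.Perm (Fin n) => ∑ j, u j * v (σ j)) + L) ∧
      |L| ≤ (3 / 2) * n *
            ((sSup (Set.range u) - sInf (Set.range u)) *
              (sSup (Set.range v) - sInf (Set.range v))) ^ 3 +
          11 * n *
            ((sSup (Set.range u) - sInf (Set.range u)) *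
              (sSup (Set.range v) - sInf (Set.range v))) ^ 4 := by
  have hn0 : 0 < n := by omega
  have hmean := pExpR_linear hn0 u v
  have hvar : pVarR (fun σ : Equiv.Perm (Fin n) => ∑ j, u j * v (σ j)) = linVar u v := by
    rw [pVarR, hmean, pExpR_sq_sub_linMean hn0]
  have hrange : ∀ (w : Fin n → ℝ) (j : Fin n), sInf (Set.range w) ≤ w j ∧
      w j ≤ sInf (Set.range w) + (sSup (Set.range w) - sInf (Set.range w)) := fun w j =>
    ⟨csInf_le (Set.finite_range w).bddBelow ⟨j, rfl⟩, by
      rw [add_sub_cancel]; exact le_csSup (Set.finite_range w).bddAbove ⟨j, rfl⟩⟩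
  refine ⟨?_, Real.log (pExpR (fun σ : Equiv.Perm (Fin n) => Real.exp (∑ j, u j * v (σ j))))
    - linMean u v - 1 / 2 * linVar u v, ?_, ?_⟩
  · have : (n : ℝ) ≠ 0 := by positivity
    rw [hmean, linMean]
    field_simp
  · rw [hmean, hvar, sub_sub, add_sub_cancel, Real.exp_log (pExpR_exp_pos _)]
  · refine (abs_log_pExpR_exp_sub_le hn0 u v (hrange u) (hrange v)).trans (le_of_eq ?_)
    ring

end Stmt5
end

section
/- Let n ≥ 2, let u, v : {1,…,n} → ℝ, let X be a uniformly random element of S_n, and for distinct j, k ∈ {1,…,n} define E_{jk}(σ) = (u(j) + v(σ_j)) (u(k) + v(σ_k)). Then E E_{jk}(X) = (u(j) + v̄)(u(k) + v̄) − (1/(n(n−1))) Σ_{i=1}^n (v(i) − v̄)², where v̄ = (1/n) Σ_{i=1}^n v(i). -/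
open scoped BigOperators

namespace Stmt7

/-- Expectation of a real function of a uniformly random permutation of `Fin n`. -/
noncomputable def pExpR {n : ℕ} (g : Equiv.Perm (Fin n) → ℝ) : ℝ :=
  (∑ σ : Equiv.Perm (Fin n), g σ) / (Nat.factorial n : ℝ)

/-- Each coordinate of a uniformly random permutation is uniformly distributed. -/
theorem card_mul_sum_perm_apply {n : ℕ} (f : Fin n → ℝ) (j : Fin n) :
    (n : ℝ) * ∑ σ : Equiv.Perm (Fin n), f (σ j) = (n.factorial : ℝ) * ∑ i, f i := by
  have hsymm (i : Fin n) :
      ∑ σ : Equiv.Perm (Fin n), f (σ i) = ∑ σ : Equiv.Perm (Fin n), f (σ j) :=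
    Fintype.sum_equiv (Equiv.mulRight (Equiv.swap i j)) _ _ fun σ => by simp
  calc (n : ℝ) * ∑ σ : Equiv.Perm (Fin n), f (σ j)
      = ∑ i, ∑ σ : Equiv.Perm (Fin n), f (σ i) := by simp [hsymm]
    _ = ∑ σ : Equiv.Perm (Fin n), ∑ i, f (σ i) := Finset.sum_comm
    _ = (n.factorial : ℝ) * ∑ i, f i := by simp [Equiv.sum_comp, Fintype.card_perm]

/-- The mixed second moment of two distinct coordinates of a random permutation, in terms of the
moments of a single coordinate. -/
theorem sub_one_mul_sum_perm_apply_mul_apply {n : ℕ} (f : Fin n → ℝ) {j k : Fin n}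
    (hjk : j ≠ k) :
    ((n : ℝ) - 1) * ∑ σ : Equiv.Perm (Fin n), f (σ j) * f (σ k) =
      (∑ i, f i) * ∑ σ : Equiv.Perm (Fin n), f (σ j) -
        ∑ σ : Equiv.Perm (Fin n), f (σ j) ^ 2 := by
  have hsymm (i : Fin n) (hi : i ∈ Finset.univ.erase j) :
      ∑ σ : Equiv.Perm (Fin n), f (σ j) * f (σ i) =
        ∑ σ : Equiv.Perm (Fin n), f (σ j) * f (σ k) :=
    Fintype.sum_equiv (Equiv.mulRight (Equiv.swap i k)) _ _ fun σ => by
      simp [Equiv.swap_apply_of_ne_of_ne (Finset.ne_of_mem_erase hi).symm hjk]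
  have hn : 1 ≤ n := by have := j.2; omega
  calc ((n : ℝ) - 1) * ∑ σ : Equiv.Perm (Fin n), f (σ j) * f (σ k)
      = ∑ i ∈ Finset.univ.erase j, ∑ σ : Equiv.Perm (Fin n), f (σ j) * f (σ i) := by
        rw [Finset.sum_congr rfl hsymm]
        simp [Nat.cast_sub hn]
    _ = ∑ σ : Equiv.Perm (Fin n), f (σ j) * ∑ i ∈ Finset.univ.erase j, f (σ i) := by
        rw [Finset.sum_comm]
        simp only [Finset.mul_sum]
    _ = ∑ σ : Equiv.Perm (Fin n), ((∑ i, f i) * f (σ j) - f (σ j) ^ 2) := by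
        refine Finset.sum_congr rfl fun σ _ => ?_
        have h := Finset.add_sum_erase Finset.univ (fun i => f (σ i)) (Finset.mem_univ j)
        rw [Equiv.sum_comp σ f] at h
        rw [← h]
        ring
    _ = _ := by rw [Finset.sum_sub_distrib, Finset.mul_sum]

theorem statement7 (n : ℕ) (hn : 2 ≤ n) (u v : Fin n → ℝ) (j k : Fin n) (hjk : j ≠ k) :
    pExpR (fun σ : Equiv.Perm (Fin n) => (u j + v (σ j)) * (u k + v (σ k))) =
      (u j + (∑ i, v i) / n) * (u k + (∑ i, v i) / n) -
        (1 / ((n : ℝ) * ((n : ℝ) - 1))) * ∑ i, (v i - (∑ l, v l) / n) ^ 2 := by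
  have hn' : (2 : ℝ) ≤ n := by exact_mod_cast hn
  have hn0 : (n : ℝ) ≠ 0 := by positivity
  have hn1 : (n : ℝ) - 1 ≠ 0 := by linarith
  have hfac : (n.factorial : ℝ) ≠ 0 := by positivity
  have hexpand : ∑ σ : Equiv.Perm (Fin n), (u j + v (σ j)) * (u k + v (σ k)) =
      (n.factorial : ℝ) * (u j * u k) + u j * ∑ σ : Equiv.Perm (Fin n), v (σ k) +
        u k * ∑ σ : Equiv.Perm (Fin n), v (σ j) +
        ∑ σ : Equiv.Perm (Fin n), v (σ j) * v (σ k) := by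
    have hconst : (n.factorial : ℝ) * (u j * u k) =
        ∑ _σ : Equiv.Perm (Fin n), u j * u k := by simp [Fintype.card_perm]
    rw [hconst, Finset.mul_sum, Finset.mul_sum, ← Finset.sum_add_distrib,
      ← Finset.sum_add_distrib, ← Finset.sum_add_distrib]
    exact Finset.sum_congr rfl fun σ _ => by ring
  have hvar : ∑ i, (v i - (∑ l, v l) / n) ^ 2 = ∑ i, v i ^ 2 - (∑ i, v i) ^ 2 / n := by
    simp only [sub_sq, Finset.sum_add_distrib, Finset.sum_sub_distrib, ← Finset.sum_mul,
      ← Finset.mul_sum, Finset.sum_const, Finset.card_univ, Fintype.card_fin, nsmul_eq_mul]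
    field_simp
    ring
  have hj := eq_div_of_mul_eq hn0 ((mul_comm _ _).trans (card_mul_sum_perm_apply v j))
  have hk := eq_div_of_mul_eq hn0 ((mul_comm _ _).trans (card_mul_sum_perm_apply v k))
  have hsq := eq_div_of_mul_eq hn0
    ((mul_comm _ _).trans (card_mul_sum_perm_apply (fun i => v i ^ 2) j))
  have hmix := eq_div_of_mul_eq hn1
    ((mul_comm _ _).trans (sub_one_mul_sum_perm_apply_mul_apply v hjk))
  rw [pExpR, hexpand, hvar, hmix, hsq, hj, hk]
  field_simp
  ring

end Stmt7
end

section
/- For any constants a, b > 0 with a + b < 1/2 and any constant C₀ > 0, there exist ε > 0, C > 0 and N such that the following holds for all n ≥ N. Let d = (d_1,…,d_n) be a graphical degree sequence satisfying δ ≤ C₀ n^{1/2+ε} and min{d̄, n − d̄ − 1} ≥ n/(3a log n). Then the expected number of spanning trees of G ∼ 𝒢_d equals n^{n−2} λ^{n−1} exp( −(1−λ)/(2λ) − R/(2λ²n) + E ) for some real E with |E| ≤ C n^{−b}. -/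
open scoped BigOperators Classical

namespace Stmt14

/-- The degree of vertex `j` in the graph `G`. -/
noncomputable def deg {n : ℕ} (G : SimpleGraph (Fin n)) (j : Fin n) : ℕ :=
  (Finset.univ.filter (fun k => G.Adj j k)).card

/-- The set of simple graphs on `{1,…,n}` with degree sequence `d`. -/
noncomputable def degFinset (n : ℕ) (d : Fin n → ℕ) : Finset (SimpleGraph (Fin n)) :=
  Finset.univ.filter (fun G => ∀ j, deg G j = d j)

/-- The average degree `d̄`. -/
noncomputable def dbar (n : ℕ) (d : Fin n → ℕ) : ℝ := (∑ j, (d j : ℝ)) / n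

/-- The edge density `λ = d̄ / (n-1)`. -/
noncomputable def lam (n : ℕ) (d : Fin n → ℕ) : ℝ := dbar n d / ((n : ℝ) - 1)

/-- `R = (1/n) Σ_j (d_j - d̄)²`. -/
noncomputable def Rpar (n : ℕ) (d : Fin n → ℕ) : ℝ :=
  (∑ j, ((d j : ℝ) - dbar n d) ^ 2) / n

/-- `δ = max_j |d_j - d̄|`. -/
noncomputable def deltaPar (n : ℕ) (d : Fin n → ℕ) : ℝ :=
  ⨆ j : Fin n, |(d j : ℝ) - dbar n d|

/-- The number of automorphisms of `H`: permutations of the vertices preserving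
the edge set. -/
noncomputable def autCard {k : ℕ} (H : SimpleGraph (Fin k)) : ℕ :=
  (Finset.univ.filter
    (fun π : Equiv.Perm (Fin k) => ∀ i j, H.Adj (π i) (π j) ↔ H.Adj i j)).card

/-- The number of spanning trees of `G`. -/
noncomputable def treeCount {n : ℕ} (G : SimpleGraph (Fin n)) : ℕ :=
  (Finset.univ.filter
    (fun K : SimpleGraph (Fin n) => K ≤ G ∧ K.IsTree)).card

/-- The expected number of spanning trees of a uniformly random graph with degree
sequence `d`. -/
noncomputable def expTrees (n : ℕ) (d : Fin n → ℕ) : ℝ :=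
  (∑ G ∈ degFinset n d, (treeCount G : ℝ)) / ((degFinset n d).card : ℝ)

open Matrix Finset in
/-- A symmetrised form of the Cauchy–Binet formula for `Y * Yᵀ`. -/
theorem factorial_mul_det_mul_transpose {V m : Type*} [Fintype V] [DecidableEq V] [Fintype m]
    (Y : Matrix V m ℝ) :
    ((Fintype.card V).factorial : ℝ) * (Y * Yᵀ).det =
      ∑ f : V → m, (Y.submatrix id f).det ^ 2 := by
  have h1 : (Y * Yᵀ).det = ∑ f : V → m, (∏ i, Y i (f i)) * (Y.submatrix id f).det := by
    simp only [det_apply', mul_apply, prod_univ_sum, mul_sum, Fintype.piFinset_univ,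
      transpose_apply, submatrix_apply, id]
    rw [Finset.sum_comm]
    refine Finset.sum_congr rfl fun f _ => Finset.sum_congr rfl fun σ _ => ?_
    rw [Finset.prod_mul_distrib]
    ring
  have h2 : ∀ τ : Equiv.Perm V, (Y * Yᵀ).det =
      ∑ f : V → m, ((Equiv.Perm.sign τ : ℤ) : ℝ) * (∏ i, Y i (f (τ i))) *
        (Y.submatrix id f).det := by
    intro τ
    rw [h1]
    refine (Fintype.sum_equiv (Equiv.arrowCongr τ.symm (Equiv.refl m)) _ _ fun f => ?_).symm
    have e1 : Y.submatrix id ((Equiv.arrowCongr τ.symm (Equiv.refl m)) f) =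
        (Y.submatrix id f).submatrix id τ := by
      ext i j; simp [Equiv.arrowCongr]
    rw [e1, det_permute']
    simp [Equiv.arrowCongr]
    ring
  have h3 : ((Fintype.card V).factorial : ℝ) * (Y * Yᵀ).det =
      ∑ τ : Equiv.Perm V, (Y * Yᵀ).det := by
    simp [Fintype.card_perm]
  rw [h3, Finset.sum_congr rfl fun τ _ => h2 τ, Finset.sum_comm]
  refine Finset.sum_congr rfl fun f _ => ?_
  rw [← Finset.sum_mul, sq]
  congr 1
  rw [← det_transpose, det_apply']
  simp

/-- The adjacency matrix over `ℝ`. -/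
noncomputable def adjM {n : ℕ} (G : SimpleGraph (Fin n)) : Matrix (Fin n) (Fin n) ℝ :=
  fun i j => if G.Adj i j then 1 else 0

/-- Edges of `G`, as increasing pairs. -/
abbrev EdgeIdx {n : ℕ} (G : SimpleGraph (Fin n)) : Type :=
  {p : Fin n × Fin n // p.1 < p.2 ∧ G.Adj p.1 p.2}

/-- The oriented incidence matrix of `G` with an additional column marking the root `r`. -/
noncomputable def incMat {n : ℕ} (R : Type) [Ring R] (G : SimpleGraph (Fin n)) (r : Fin n) :
    Matrix (Fin n) (Option (EdgeIdx G)) R :=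
  fun i c => c.elim (if i = r then 1 else 0)
    fun p => (if i = p.1.1 then 1 else 0) - (if i = p.1.2 then 1 else 0)

/-- The graph formed by the edges selected by `f`. -/
def edgeGraph {n : ℕ} {G : SimpleGraph (Fin n)} (f : Fin n → Option (EdgeIdx G)) :
    SimpleGraph (Fin n) where
  Adj u v := ∃ p : EdgeIdx G, some p ∈ Set.range f ∧ (p.1 = (u, v) ∨ p.1 = (v, u))
  symm := ⟨fun _ _ ⟨p, hp, h⟩ => ⟨p, hp, h.symm⟩⟩
  loopless := ⟨by
    rintro u ⟨p, -, h | h⟩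
    · have := p.2.1; rw [h] at this; exact lt_irrefl _ this
    · have := p.2.1; rw [h] at this; exact lt_irrefl _ this⟩

theorem edgeGraph_le {n : ℕ} {G : SimpleGraph (Fin n)} (f : Fin n → Option (EdgeIdx G)) :
    edgeGraph f ≤ G := by
  rintro u v ⟨p, -, h | h⟩
  · have := p.2.2; rwa [h] at this
  · have := p.2.2; rw [h] at this; exact this.symm

theorem adjM_symm {n : ℕ} (G : SimpleGraph (Fin n)) (i j : Fin n) : adjM G i j = adjM G j i := by
  simp [adjM, G.adj_comm]

theorem sum_adjM {n : ℕ} (G : SimpleGraph (Fin n)) (i : Fin n) :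
    ∑ j, adjM G i j = deg G i := by
  simp [adjM, deg]

open Matrix in
theorem incMat_mul_transpose {n : ℕ} (G : SimpleGraph (Fin n)) (r : Fin n) :
    incMat ℝ G r * (incMat ℝ G r)ᵀ =
      diagonal (fun i => (deg G i : ℝ)) - adjM G +
        vecMulVec (Pi.single r 1) (Pi.single r 1) := by
  ext i j
  set g : Fin n → Fin n → ℝ := fun u v =>
    ((if i = u then 1 else 0) - (if i = v then 1 else 0)) *
      ((if j = u then 1 else 0) - (if j = v then 1 else 0)) with hg
  have hgs : ∀ u v, g u v = g v u := fun u v => by simp only [hg]; ring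
  have h1 : ∑ p : EdgeIdx G, g p.1.1 p.1.2 =
      ∑ u, ∑ v, if u < v then adjM G u v * g u v else 0 := by
    rw [← Fintype.sum_prod_type' (f := fun u v => if u < v then adjM G u v * g u v else 0),
      ← Finset.sum_subtype (Finset.univ.filter
        fun p : Fin n × Fin n => p.1 < p.2 ∧ G.Adj p.1 p.2) (by simp)
        (fun p : Fin n × Fin n => g p.1 p.2), Finset.sum_filter]
    refine Finset.sum_congr rfl fun p _ => ?_
    by_cases h : p.1 < p.2 <;> simp [h, adjM]
  have h2 : ∑ u, ∑ v, adjM G u v * g u v =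
      2 * ∑ u, ∑ v, if u < v then adjM G u v * g u v else 0 := by
    have e : ∀ u v, adjM G u v * g u v = (if u < v then adjM G u v * g u v else 0) +
        (if v < u then adjM G v u * g v u else 0) := by
      intro u v
      rcases lt_trichotomy u v with h | h | h
      · simp [h, h.le]
      · simp [h, adjM]
      · simp [h, h.le, adjM_symm G u v, hgs u v]
    rw [Finset.sum_congr rfl fun u _ => Finset.sum_congr rfl fun v _ => e u v]
    simp only [Finset.sum_add_distrib]
    rw [two_mul]
    congr 1
    exact Finset.sum_comm
  have h3 : ∑ u, ∑ v, adjM G u v * g u v =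
      2 * ((if i = j then (deg G i : ℝ) else 0) - adjM G i j) := by
    have e : ∀ u v, adjM G u v * g u v =
        (if i = u then if j = u then adjM G u v else 0 else 0)
        - (if i = u then if j = v then adjM G u v else 0 else 0)
        - (if j = u then if i = v then adjM G u v else 0 else 0)
        + (if i = v then if j = v then adjM G v u else 0 else 0) := by
      intro u v
      simp only [hg]
      rw [adjM_symm G v u]
      split_ifs <;> simp
    rw [Finset.sum_congr rfl fun u _ => Finset.sum_congr rfl fun v _ => e u v]
    simp only [Finset.sum_add_distrib, Finset.sum_sub_distrib]
    rw [Finset.sum_comm (f := fun u v => if i = v then if j = v then adjM G v u else 0 else 0)]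
    simp [sum_adjM]
    rw [adjM_symm G j i]
    simp only [eq_comm (a := j) (b := i)]
    ring
  rw [mul_apply, Fintype.sum_option]
  simp only [incMat, transpose_apply, Option.elim, vecMulVec_apply, Matrix.add_apply, Matrix.sub_apply,
    diagonal_apply]
  have h4 := h1.trans (by linarith : _ = ((if i = j then (deg G i : ℝ) else 0) - adjM G i j))
  simp only [hg] at h4
  rw [h4]
  simp [Pi.single_apply]
  ring

theorem sum_mul_incMat {n : ℕ} {R : Type} [Ring R] {G : SimpleGraph (Fin n)} (r : Fin n)
    (x : Fin n → R) (c : Option (EdgeIdx G)) :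
    ∑ i, x i * incMat R G r i c = c.elim (x r) fun p => x p.1.1 - x p.1.2 := by
  cases c <;> simp [incMat, mul_sub]

theorem det_incMat_eq_zero {n : ℕ} {G : SimpleGraph (Fin n)} (r : Fin n)
    (f : Fin n → Option (EdgeIdx G)) (h : ¬ (none ∈ Set.range f ∧ (edgeGraph f).Connected)) :
    ((incMat ℝ G r).submatrix id f).det = 0 := by
  rw [← Matrix.exists_vecMul_eq_zero_iff]
  rw [not_and_or] at h
  rcases h with h | h
  · refine ⟨fun _ => 1, fun h0 => one_ne_zero (congrFun h0 r), ?_⟩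
    ext j
    have := sum_mul_incMat (R := ℝ) r (fun _ => 1) (f j)
    simp only [Matrix.vecMul, dotProduct, Matrix.submatrix_apply, id, this]
    cases hj : f j with
    | none => exact absurd ⟨j, hj⟩ h
    | some p => simp
  · have hex : ∃ v, ¬ (edgeGraph f).Reachable r v := by
      by_contra! hc
      have : Nonempty (Fin n) := ⟨r⟩
      exact h ⟨fun u v => (hc u).symm.trans (hc v)⟩
    obtain ⟨v, hv⟩ := hex
    refine ⟨fun i => if (edgeGraph f).Reachable r i then 0 else 1,
      fun h0 => by simpa [hv] using congrFun h0 v, ?_⟩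
    ext j
    have := sum_mul_incMat (R := ℝ) r
      (fun i => if (edgeGraph f).Reachable r i then 0 else 1) (f j)
    simp only [Matrix.vecMul, dotProduct, Matrix.submatrix_apply, id, this]
    cases hj : f j with
    | none => simp
    | some p =>
      have hadj : (edgeGraph f).Adj p.1.1 p.1.2 := ⟨p, ⟨j, hj⟩, Or.inl rfl⟩
      have : (edgeGraph f).Reachable r p.1.1 ↔ (edgeGraph f).Reachable r p.1.2 :=
        ⟨fun h => h.trans hadj.reachable, fun h => h.trans hadj.symm.reachable⟩
      simp [this]

theorem det_incMat_sq {n : ℕ} {G : SimpleGraph (Fin n)} (r : Fin n)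
    (f : Fin n → Option (EdgeIdx G)) (h0 : none ∈ Set.range f) (hc : (edgeGraph f).Connected) :
    ((incMat ℝ G r).submatrix id f).det ^ 2 = 1 := by
  set M := (incMat ℤ G r).submatrix id f with hM
  have hcol : ∀ j, (fun i => incMat ℤ G r i (f j)) ∈ LinearMap.range M.mulVecLin := by
    intro j
    refine ⟨Pi.single j 1, ?_⟩
    ext i
    simp [hM]
  have hroot : (Pi.single r 1 : Fin n → ℤ) ∈ LinearMap.range M.mulVecLin := by
    obtain ⟨j, hj⟩ := h0
    convert hcol j using 1
    ext i
    simp [hj, incMat, Pi.single_apply]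
  have hedge : ∀ u v, (edgeGraph f).Adj u v →
      (Pi.single u 1 - Pi.single v 1 : Fin n → ℤ) ∈ LinearMap.range M.mulVecLin := by
    have key : ∀ p : EdgeIdx G, some p ∈ Set.range f →
        (Pi.single p.1.1 1 - Pi.single p.1.2 1 : Fin n → ℤ) ∈ LinearMap.range M.mulVecLin := by
      rintro p ⟨j, hj⟩
      convert hcol j using 1
      ext i
      simp [hj, incMat, Pi.single_apply]
    rintro u v ⟨p, hp, h | h⟩
    · have := key p hp
      rwa [h] at this
    · have := Submodule.neg_mem _ (key p hp)
      rwa [h, neg_sub] at this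
  have hwalk : ∀ u v, (edgeGraph f).Walk u v →
      (Pi.single u 1 - Pi.single v 1 : Fin n → ℤ) ∈ LinearMap.range M.mulVecLin := by
    intro u v w
    induction w with
    | nil => simp
    | cons h _ ih =>
      have := Submodule.add_mem _ (hedge _ _ h) ih
      simpa using this
  have hall : ∀ v, (Pi.single v 1 : Fin n → ℤ) ∈ LinearMap.range M.mulVecLin := by
    intro v
    obtain ⟨w⟩ := hc.preconnected v r
    have := Submodule.add_mem _ (hwalk _ _ w) hroot
    simpa using this
  have hsurj : Function.Surjective M.mulVec := by
    intro y
    have : y ∈ LinearMap.range M.mulVecLin := by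
      have hy : y = ∑ v, y v • (Pi.single v 1 : Fin n → ℤ) := by
        ext i; simp [Finset.sum_apply, Pi.single_apply]
      rw [hy]
      exact Submodule.sum_mem _ fun v _ => Submodule.smul_mem _ _ (hall v)
    obtain ⟨x, hx⟩ := this
    exact ⟨x, hx⟩
  have hu : IsUnit M.det := (Matrix.isUnit_iff_isUnit_det M).1
    (Matrix.mulVec_surjective_iff_isUnit.1 hsurj)
  have hsq : M.det ^ 2 = 1 := by
    rcases Int.isUnit_iff.1 hu with h | h <;> simp [h]
  have hcast : (incMat ℝ G r).submatrix id f = M.map (Int.castRingHom ℝ) := by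
    ext i j
    cases hj : f j <;> simp [hM, incMat, hj]
  rw [hcast, ← RingHom.mapMatrix_apply, ← RingHom.map_det]
  simpa using congrArg (Int.cast : ℤ → ℝ) hsq

/-- The columns of the rooted incidence matrix of `G` that belong to the subgraph `K`. -/
noncomputable def treeCols {n : ℕ} (G K : SimpleGraph (Fin n)) : Finset (Option (EdgeIdx G)) :=
  Finset.insertNone (Finset.univ.filter fun p : EdgeIdx G => K.Adj p.1.1 p.1.2)

theorem card_treeCols {n : ℕ} {G K : SimpleGraph (Fin n)} (h : K ≤ G) :
    (treeCols G K).card = Nat.card K.edgeSet + 1 := by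
  rw [treeCols, Finset.card_insertNone, ← Fintype.card_subtype, ← Nat.card_eq_fintype_card]
  congr 1
  refine Nat.card_eq_of_bijective
    (fun p : {p : EdgeIdx G // K.Adj p.1.1 p.1.2} =>
      (⟨s(p.1.1.1, p.1.1.2), p.2⟩ : K.edgeSet)) ⟨?_, ?_⟩
  · rintro ⟨⟨⟨a, b⟩, hab, _⟩, _⟩ ⟨⟨⟨c, d⟩, hcd, _⟩, _⟩ heq
    have heq' : s(a, b) = s(c, d) := congrArg Subtype.val heq
    rcases Sym2.eq_iff.1 heq' with ⟨rfl, rfl⟩ | ⟨rfl, rfl⟩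
    · rfl
    · exact absurd hab (lt_asymm hcd)
  · rintro ⟨e, he⟩
    induction e using Sym2.ind with
    | _ a b =>
      have hab : K.Adj a b := he
      rcases lt_or_gt_of_ne hab.ne with hlt | hlt
      · exact ⟨⟨⟨(a, b), hlt, h hab⟩, hab⟩, rfl⟩
      · exact ⟨⟨⟨(b, a), hlt, (h hab).symm⟩, hab.symm⟩, Subtype.ext Sym2.eq_swap⟩

theorem image_eq_treeCols {n : ℕ} {G : SimpleGraph (Fin n)} (f : Fin n → Option (EdgeIdx G))
    (h0 : none ∈ Set.range f) : Finset.univ.image f = treeCols G (edgeGraph f) := by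
  ext c
  cases c with
  | none => simpa [treeCols] using h0
  | some p =>
    simp only [treeCols, Finset.mem_image, Finset.mem_univ, true_and, Finset.some_mem_insertNone,
      Finset.mem_filter]
    constructor
    · rintro ⟨i, hi⟩
      exact ⟨p, ⟨i, hi⟩, Or.inl rfl⟩
    · rintro ⟨q, ⟨i, hi⟩, h | h⟩
      · exact ⟨i, by rw [hi, Subtype.ext h]⟩
      · have := q.2.1
        rw [h] at this
        exact absurd this (lt_asymm p.2.1)

theorem card_injective_image_eq {n : ℕ} {α : Type*} [Fintype α] [DecidableEq α] (S : Finset α)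
    (hS : S.card = n) :
    (Finset.univ.filter fun f : Fin n → α =>
      Function.Injective f ∧ Finset.univ.image f = S).card = n.factorial := by
  have e0 : Fin n ≃ S := (S.equivFinOfCardEq hS).symm
  have : Fintype.card (Fin n ≃ S) = n.factorial := by
    rw [Fintype.card_equiv e0, Fintype.card_fin]
  rw [← this, ← Finset.card_univ]
  symm
  refine Finset.card_bij (fun e _ i => (e i : α)) ?_ ?_ ?_
  · intro e _
    simp only [Finset.mem_filter, Finset.mem_univ, true_and]
    refine ⟨fun i j h => e.injective (Subtype.ext h), ?_⟩
    ext a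
    simp only [Finset.mem_image, Finset.mem_univ, true_and]
    constructor
    · rintro ⟨i, rfl⟩
      exact (e i).2
    · intro ha
      exact ⟨e.symm ⟨a, ha⟩, by simp⟩
  · intro e _ e' _ h
    ext i
    exact congrFun h i
  · intro f hf
    simp only [Finset.mem_filter, Finset.mem_univ, true_and] at hf
    obtain ⟨hinj, him⟩ := hf
    have hmem : ∀ i, f i ∈ S := fun i => him ▸ Finset.mem_image_of_mem f (Finset.mem_univ i)
    refine ⟨Equiv.ofBijective (fun i => (⟨f i, hmem i⟩ : S)) ⟨?_, ?_⟩, Finset.mem_univ _, rfl⟩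
    · intro i j h
      exact hinj (congrArg Subtype.val h)
    · rintro ⟨a, ha⟩
      rw [← him] at ha
      obtain ⟨i, -, hi⟩ := Finset.mem_image.1 ha
      exact ⟨i, Subtype.ext hi⟩

open Matrix in
theorem det_rooted_laplacian {n : ℕ} (G : SimpleGraph (Fin n)) (r : Fin n) :
    (diagonal (fun i => (deg G i : ℝ)) - adjM G +
        vecMulVec (Pi.single r 1) (Pi.single r 1)).det = (treeCount G : ℝ) := by
  set P : (Fin n → Option (EdgeIdx G)) → Prop :=
    fun f => none ∈ Set.range f ∧ (edgeGraph f).Connected with hP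
  have hinj : ∀ f, P f → Function.Injective f := by
    intro f hf i j hij
    by_contra hne
    have h1 := det_incMat_sq r f hf.1 hf.2
    have h2 : ((incMat ℝ G r).submatrix id f).det = 0 :=
      det_zero_of_column_eq hne fun k => by simp [hij]
    rw [h2] at h1
    norm_num at h1
  have htree : ∀ f, P f → (edgeGraph f).IsTree := by
    intro f hf
    rw [SimpleGraph.isTree_iff_connected_and_card]
    refine ⟨hf.2, ?_⟩
    rw [← card_treeCols (edgeGraph_le f), ← image_eq_treeCols f hf.1,
      Finset.card_image_of_injective _ (hinj f hf)]
    simp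
  have hfib : ∀ K : SimpleGraph (Fin n), K ≤ G → K.IsTree →
      ((Finset.univ.filter P).filter fun f => edgeGraph f = K).card = n.factorial := by
    intro K hK hT
    rw [← card_injective_image_eq (treeCols G K)
      (by rw [card_treeCols hK, (SimpleGraph.isTree_iff_connected_and_card.1 hT).2]; simp)]
    congr 1
    ext f
    simp only [Finset.mem_filter, Finset.mem_univ, true_and]
    constructor
    · rintro ⟨hf, rfl⟩
      exact ⟨hinj f hf, image_eq_treeCols f hf.1⟩
    · rintro ⟨-, him⟩
      have hmem : ∀ c, c ∈ Set.range f ↔ c ∈ treeCols G K := by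
        intro c
        rw [← him]
        simp
      have h0 : none ∈ Set.range f := (hmem _).2 (by simp [treeCols])
      have heq : edgeGraph f = K := by
        ext u v
        constructor
        · rintro ⟨p, hp, h⟩
          rw [hmem] at hp
          have : K.Adj p.1.1 p.1.2 := by simpa [treeCols] using hp
          rcases h with h | h
          · rwa [h] at this
          · rw [h] at this; exact this.symm
        · intro huv
          rcases lt_or_gt_of_ne huv.ne with hlt | hlt
          · exact ⟨⟨(u, v), hlt, hK huv⟩, (hmem _).2 (by simpa [treeCols] using huv), Or.inl rfl⟩
          · exact ⟨⟨(v, u), hlt, (hK huv).symm⟩,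
              (hmem _).2 (by simpa [treeCols] using huv.symm), Or.inr rfl⟩
      exact ⟨⟨h0, heq ▸ hT.connected⟩, heq⟩
  have hcard : (Finset.univ.filter P).card = treeCount G * n.factorial := by
    rw [Finset.card_eq_sum_card_fiberwise (f := edgeGraph)
      (t := Finset.univ.filter fun K : SimpleGraph (Fin n) => K ≤ G ∧ K.IsTree)
      (by
        intro f hf
        have hf' : P f := by simpa using hf
        simpa using ⟨edgeGraph_le f, htree f hf'⟩)]
    rw [Finset.sum_congr rfl fun K hK => hfib K (Finset.mem_filter.1 hK).2.1
      (Finset.mem_filter.1 hK).2.2]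
    simp [treeCount]
  have hmain := factorial_mul_det_mul_transpose (incMat ℝ G r)
  rw [incMat_mul_transpose, Fintype.card_fin] at hmain
  have hsum : ∑ f, ((incMat ℝ G r).submatrix id f).det ^ 2 = ((Finset.univ.filter P).card : ℝ) := by
    rw [Finset.card_filter, Nat.cast_sum]
    refine Finset.sum_congr rfl fun f _ => ?_
    by_cases hf : P f
    · rw [if_pos hf, det_incMat_sq r f hf.1 hf.2, Nat.cast_one]
    · rw [if_neg hf, det_incMat_eq_zero r f hf, Nat.cast_zero, sq, zero_mul]
  rw [hsum, hcard] at hmain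
  have hne : (n.factorial : ℝ) ≠ 0 := by exact_mod_cast n.factorial_ne_zero
  refine mul_left_cancel₀ hne ?_
  rw [hmain]
  push_cast
  ring

open Matrix in
/-- A form of the **matrix-tree theorem**. -/
theorem det_laplacian_add_const {n : ℕ} (hn : 0 < n) (G : SimpleGraph (Fin n)) {s : ℝ}
    (hs : 0 ≤ s) :
    (diagonal (fun i => (deg G i : ℝ)) - adjM G + s • of fun _ _ => 1).det =
      s * n ^ 2 * treeCount G := by
  set r : Fin n := ⟨0, hn⟩
  rw [← det_rooted_laplacian G r]
  set L := diagonal (fun i => (deg G i : ℝ)) - adjM G with hL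
  set e : Fin n → ℝ := Pi.single r 1 with he
  set one : Fin n → ℝ := fun _ => 1 with hone
  set v : Fin n → ℝ := Real.sqrt s • one - e with hv
  have hL1 : L *ᵥ one = 0 := by
    ext i
    simp [hL, hone, mulVec, dotProduct, sum_adjM, diagonal_apply]
  have hLs : Lᵀ = L := by
    ext i j
    simp only [hL, transpose_apply, Matrix.sub_apply, diagonal_apply, adjM_symm G j i]
    by_cases h : i = j
    · simp [h]
    · simp [h, Ne.symm h]
  have h1L : one ᵥ* L = 0 := by
    rw [← hLs, vecMul_transpose, hL1]
  have h1e : one ⬝ᵥ e = 1 := by simp [hone, he]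
  have he1 : e ⬝ᵥ one = 1 := by simp [hone, he]
  have key : (1 + vecMulVec v one) * (L + vecMulVec e e) * (1 + vecMulVec one v) =
      L + s • of fun _ _ => 1 := by
    have hev : e + v = Real.sqrt s • one := by simp [hv]
    have e1 : (1 + vecMulVec v one) * (L + vecMulVec e e) = L + vecMulVec (e + v) e := by
      rw [add_mul, one_mul, mul_add, vecMulVec_mul, h1L, vecMulVec_mul_vecMulVec, h1e,
        add_vecMulVec]
      simp
      abel
    have e2 : (L + vecMulVec (e + v) e) * (1 + vecMulVec one v) =
        L + vecMulVec (e + v) (e + v) := by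
      rw [mul_add, mul_one, add_mul, mul_vecMulVec, hL1, vecMulVec_mul_vecMulVec, he1,
        vecMulVec_add]
      simp
      abel
    rw [e1, e2, hev]
    congr 1
    ext i j
    simp [vecMulVec_apply, hone, Real.mul_self_sqrt hs]
  have hd : (1 + vecMulVec v one).det = Real.sqrt s * n := by
    rw [vecMulVec_eq Unit, det_one_add_replicateCol_mul_replicateRow]
    simp [hone, hv, he, dotProduct, mul_comm]
  have hd' : (1 + vecMulVec one v).det = Real.sqrt s * n := by
    rw [← hd, ← det_transpose]
    simp [transpose_vecMulVec]
  rw [← key, det_mul, det_mul, hd, hd']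
  have := Real.mul_self_sqrt hs
  linear_combination (n : ℝ) ^ 2 * (L + vecMulVec e e).det * this

/-- The squared Frobenius norm. -/
noncomputable def frobSq {n : ℕ} (M : Matrix (Fin n) (Fin n) ℝ) : ℝ := ∑ i, ∑ j, M i j ^ 2

theorem frobSq_nonneg {n : ℕ} (M : Matrix (Fin n) (Fin n) ℝ) : 0 ≤ frobSq M :=
  Finset.sum_nonneg fun _ _ => Finset.sum_nonneg fun _ _ => sq_nonneg _

theorem abs_log_one_sub_le {x : ℝ} (hx : |x| ≤ 1 / 2) :
    |Real.log (1 - x) + x + x ^ 2 / 2| ≤ 2 * |x| ^ 3 := by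
  have h := Real.abs_log_sub_add_sum_range_le (x := x) (by linarith) 2
  have e : ∑ i ∈ Finset.range 2, x ^ (i + 1) / ((i : ℝ) + 1) + Real.log (1 - x) =
      Real.log (1 - x) + x + x ^ 2 / 2 := by
    simp [Finset.sum_range_succ]
    ring
  rw [e] at h
  refine h.trans ?_
  rw [div_le_iff₀ (by linarith)]
  have : 0 ≤ |x| ^ 3 := by positivity
  norm_num only
  nlinarith

open Matrix in
theorem trace_pow_eq_sum_eigenvalues {n : ℕ} {N : Matrix (Fin n) (Fin n) ℝ} (hN : N.IsHermitian)
    (k : ℕ) : (N ^ k).trace = ∑ i, hN.eigenvalues i ^ k := by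
  conv_lhs => rw [hN.spectral_theorem, ← map_pow, Unitary.conjStarAlgAut_apply,
    trace_mul_cycle, Unitary.coe_star_mul_self, one_mul, diagonal_pow]
  simp [trace]

open Matrix in
theorem det_one_sub_eq_prod {n : ℕ} {N : Matrix (Fin n) (Fin n) ℝ} (hN : N.IsHermitian) :
    (1 - N).det = ∏ i, (1 - hN.eigenvalues i) := by
  have h := N.eval_charpoly 1
  rw [hN.charpoly_eq] at h
  simp [Polynomial.eval_prod] at h
  rw [← h]

open Matrix in
theorem trace_sq_eq_frobSq {n : ℕ} {N : Matrix (Fin n) (Fin n) ℝ} (hN : N.IsHermitian) :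
    (N ^ 2).trace = frobSq N := by
  simp only [trace, sq, diag_apply, mul_apply, frobSq]
  refine Finset.sum_congr rfl fun i _ => Finset.sum_congr rfl fun j _ => ?_
  have : N j i = N i j := by simpa using hN.apply i j
  rw [this]

open Matrix in
theorem det_one_sub_eq_exp {n : ℕ} {N : Matrix (Fin n) (Fin n) ℝ} (hN : N.IsHermitian)
    (h4 : 16 * frobSq (N * N) ≤ 1) :
    ∃ θ : ℝ, |θ| ≤ 2 * Real.sqrt (frobSq N * frobSq (N * N)) ∧
      (1 - N).det = Real.exp (-N.trace - frobSq N / 2 + θ) := by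
  set ν := hN.eigenvalues with hν
  have t1 : N.trace = ∑ i, ν i := by simpa using trace_pow_eq_sum_eigenvalues hN 1
  have t2 : frobSq N = ∑ i, ν i ^ 2 := by
    rw [← trace_sq_eq_frobSq hN, trace_pow_eq_sum_eigenvalues hN 2]
  have hN2 : (N * N).IsHermitian := by
    rw [IsHermitian, conjTranspose_mul, hN.eq]
  have t4 : frobSq (N * N) = ∑ i, ν i ^ 4 := by
    rw [← trace_sq_eq_frobSq hN2, ← sq, ← pow_mul, trace_pow_eq_sum_eigenvalues hN]
  have hsmall : ∀ i, |ν i| ≤ 1 / 2 := by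
    intro i
    have h1 : ν i ^ 4 ≤ ∑ i, ν i ^ 4 :=
      Finset.single_le_sum (f := fun i => ν i ^ 4) (fun i _ => by positivity) (Finset.mem_univ i)
    have h2 : |ν i| ^ 4 ≤ (1 / 2) ^ 4 := by
      rw [show |ν i| ^ 4 = ν i ^ 4 from Even.pow_abs (by decide) _]
      rw [← t4] at h1
      linarith
    exact le_of_pow_le_pow_left₀ (by norm_num) (by norm_num) h2
  refine ⟨∑ i, (Real.log (1 - ν i) + ν i + ν i ^ 2 / 2), ?_, ?_⟩
  · calc |∑ i, (Real.log (1 - ν i) + ν i + ν i ^ 2 / 2)|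
        ≤ ∑ i, |Real.log (1 - ν i) + ν i + ν i ^ 2 / 2| := Finset.abs_sum_le_sum_abs _ _
      _ ≤ ∑ i, 2 * |ν i| ^ 3 := Finset.sum_le_sum fun i _ => abs_log_one_sub_le (hsmall i)
      _ = 2 * ∑ i, |ν i| * |ν i| ^ 2 := by
        rw [Finset.mul_sum]
        exact Finset.sum_congr rfl fun i _ => by ring
      _ ≤ 2 * Real.sqrt (frobSq N * frobSq (N * N)) := by
        gcongr
        apply Real.le_sqrt_of_sq_le
        have := Finset.sum_mul_sq_le_sq_mul_sq Finset.univ (fun i => |ν i|) (fun i => |ν i| ^ 2)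
        rw [t2, t4]
        simpa [← pow_mul] using this
  · rw [det_one_sub_eq_prod hN, t1, t2]
    have : -∑ i, ν i - (∑ i, ν i ^ 2) / 2 + ∑ i, (Real.log (1 - ν i) + ν i + ν i ^ 2 / 2) =
        ∑ i, Real.log (1 - ν i) := by
      simp only [Finset.sum_add_distrib, Finset.sum_div]
      ring
    rw [this, Real.exp_sum]
    refine Finset.prod_congr rfl fun i _ => ?_
    have := abs_le.1 (hsmall i)
    rw [Real.exp_log (by linarith)]

open Matrix in
theorem det_le_exp_trace_sub {n : ℕ} {Q : Matrix (Fin n) (Fin n) ℝ} (hQ : Q.PosSemidef) :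
    Q.det ≤ Real.exp (Q.trace - n) := by
  have h1 := hQ.isHermitian.det_eq_prod_eigenvalues
  have h2 := hQ.isHermitian.trace_eq_sum_eigenvalues
  simp only [RCLike.ofReal_real_eq_id, id] at h1 h2
  rw [h1, h2]
  have : ∑ i, hQ.isHermitian.eigenvalues i - (n : ℝ) =
      ∑ i, (hQ.isHermitian.eigenvalues i - 1) := by
    simp
  rw [this, Real.exp_sum]
  refine Finset.prod_le_prod (fun i _ => hQ.eigenvalues_nonneg i) fun i _ => ?_
  have := Real.add_one_le_exp (hQ.isHermitian.eigenvalues i - 1)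
  linarith

open Matrix in
theorem det_le_prod_mul_exp {n : ℕ} {P : Matrix (Fin n) (Fin n) ℝ} (hP : P.PosSemidef)
    (w : Fin n → ℝ) (hw : ∀ i, 0 < w i) :
    P.det ≤ (∏ i, w i) * Real.exp (∑ i, P i i / w i - n) := by
  set D : Matrix (Fin n) (Fin n) ℝ := diagonal fun i => (Real.sqrt (w i))⁻¹ with hD
  have hDs : Dᴴ = D := by simp [hD]
  have hQ : (D * P * D).PosSemidef := by
    have := hP.mul_mul_conjTranspose_same D
    rwa [hDs] at this
  have h := det_le_exp_trace_sub hQ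
  have ht : (D * P * D).trace = ∑ i, P i i / w i := by
    simp only [trace, hD, diag_apply, mul_diagonal, diagonal_mul]
    refine Finset.sum_congr rfl fun i _ => ?_
    have h1 := Real.mul_self_sqrt (hw i).le
    have h2 : (Real.sqrt (w i))⁻¹ * (Real.sqrt (w i))⁻¹ = (w i)⁻¹ := by rw [← mul_inv, h1]
    rw [div_eq_mul_inv, ← h2]
    ring
  have hd : (∏ i, w i) * (D * P * D).det = P.det := by
    have h1 : (∏ i, w i) * (D.det * D.det) = 1 := by
      rw [hD, det_diagonal, ← Finset.prod_mul_distrib, ← Finset.prod_mul_distrib]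
      refine Finset.prod_eq_one fun i _ => ?_
      have h1 := Real.mul_self_sqrt (hw i).le
      rw [← mul_inv, h1, mul_inv_cancel₀ (hw i).ne']
    rw [det_mul, det_mul]
    linear_combination P.det * h1
  rw [← hd, ← ht]
  exact mul_le_mul_of_nonneg_left h (Finset.prod_nonneg fun i _ => (hw i).le)

open Matrix in
theorem posSemidef_laplacian_add_const {n : ℕ} (G : SimpleGraph (Fin n)) {s : ℝ} (hs : 0 ≤ s) :
    (diagonal (fun i => (deg G i : ℝ)) - adjM G + s • of fun _ _ => 1).PosSemidef := by
  have h1 : diagonal (fun i => (deg G i : ℝ)) - adjM G = G.lapMatrix ℝ := by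
    ext i j
    simp [SimpleGraph.lapMatrix, SimpleGraph.degMatrix, adjM, deg, diagonal_apply,
      ← SimpleGraph.card_neighborFinset_eq_degree, SimpleGraph.neighborFinset_eq_filter]
  have h2 : (s • of fun _ _ => 1 : Matrix (Fin n) (Fin n) ℝ) =
      s • vecMulVec (fun _ => 1) (star fun _ => 1) := by
    ext i j
    simp [vecMulVec_apply]
  rw [h1, h2]
  exact (G.posSemidef_lapMatrix ℝ).add ((posSemidef_vecMulVec_self_star _).smul hs)

/-- The change of the adjacency matrix when the edges `xy`, `zw` are replaced by `xz`, `yw`. -/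
noncomputable def switchMat {n : ℕ} (x y z w : Fin n) : Matrix (Fin n) (Fin n) ℝ :=
  Matrix.vecMulVec (Pi.single x 1 - Pi.single w 1) (Pi.single z 1 - Pi.single y 1) +
    Matrix.vecMulVec (Pi.single z 1 - Pi.single y 1) (Pi.single x 1 - Pi.single w 1)

/-- The edges `xy`, `zw` of `G` can be replaced by `xz`, `yw`. -/
def Switchable {n : ℕ} (G : SimpleGraph (Fin n)) (x y z w : Fin n) : Prop :=
  G.Adj x y ∧ G.Adj z w ∧ (x ≠ z ∧ ¬ G.Adj x z) ∧ (y ≠ w ∧ ¬ G.Adj y w)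

/-- The graph obtained from `G` by replacing the edges `xy`, `zw` by `xz`, `yw`. -/
noncomputable def switch {n : ℕ} (G : SimpleGraph (Fin n)) (x y z w : Fin n) :
    SimpleGraph (Fin n) :=
  SimpleGraph.fromRel fun u v => (adjM G + switchMat x y z w) u v = 1

theorem switchMat_apply {n : ℕ} (x y z w u v : Fin n) :
    switchMat x y z w u v =
      ((if u = x then 1 else 0) - (if u = w then 1 else 0)) *
        ((if v = z then 1 else 0) - (if v = y then 1 else 0)) +
      ((if u = z then 1 else 0) - (if u = y then 1 else 0)) *
        ((if v = x then 1 else 0) - (if v = w then 1 else 0)) := by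
  simp [switchMat, Matrix.vecMulVec_apply, Pi.single_apply]

theorem switchMat_symm {n : ℕ} (x y z w u v : Fin n) :
    switchMat x y z w u v = switchMat x y z w v u := by
  rw [switchMat_apply, switchMat_apply]
  ring

theorem switchMat_swap {n : ℕ} (x y z w : Fin n) :
    switchMat x z y w = - switchMat x y z w := by
  ext u v
  rw [Matrix.neg_apply, switchMat_apply, switchMat_apply]
  ring

theorem adjM_add_switchMat {n : ℕ} {G : SimpleGraph (Fin n)} {x y z w : Fin n}
    (h : Switchable G x y z w) (u v : Fin n) :
    ((adjM G + switchMat x y z w) u v = 0 ∨ (adjM G + switchMat x y z w) u v = 1) ∧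
      (adjM G + switchMat x y z w) u u = 0 := by
  obtain ⟨hxy, hzw, ⟨hxz, hnxz⟩, hyw, hnyw⟩ := h
  have nxy := hxy.ne
  have nzw := hzw.ne
  have nxw : x ≠ w := by rintro rfl; exact hnxz hzw.symm
  have nyz : y ≠ z := by rintro rfl; exact hnxz hxy
  have hyx := hxy.symm
  have hwz := hzw.symm
  have hnzx : ¬ G.Adj z x := fun h => hnxz h.symm
  have hnwy : ¬ G.Adj w y := fun h => hnyw h.symm
  rw [Matrix.add_apply, Matrix.add_apply, switchMat_apply, switchMat_apply]
  have hA : adjM G u v = 0 ∨ adjM G u v = 1 := by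
    unfold adjM
    split_ifs <;> simp
  have hxy' : adjM G x y = 1 := by simp [adjM, hxy]
  have hyx' : adjM G y x = 1 := by simp [adjM, hyx]
  have hzw' : adjM G z w = 1 := by simp [adjM, hzw]
  have hwz' : adjM G w z = 1 := by simp [adjM, hwz]
  have hxz' : adjM G x z = 0 := by simp [adjM, hnxz]
  have hzx' : adjM G z x = 0 := by simp [adjM, hnzx]
  have hyw' : adjM G y w = 0 := by simp [adjM, hnyw]
  have hwy' : adjM G w y = 0 := by simp [adjM, hnwy]
  have hdiag : adjM G u u = 0 := by simp [adjM]
  constructor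
  · by_cases ux : u = x
    · subst ux
      by_cases vy : v = y
      · subst vy; simp [*, Ne.symm]
      by_cases vz : v = z
      · subst vz; simp [*, Ne.symm]
      simp [*, Ne.symm]
    by_cases uy : u = y
    · subst uy
      by_cases vy : v = x
      · subst vy; simp [*, Ne.symm]
      by_cases vz : v = w
      · subst vz; simp [*, Ne.symm]
      simp [*, Ne.symm]
    by_cases uz : u = z
    · subst uz
      by_cases vy : v = x
      · subst vy; simp [*, Ne.symm]
      by_cases vz : v = w
      · subst vz; simp [*, Ne.symm]
      simp [*, Ne.symm]
    by_cases uw : u = w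
    · subst uw
      by_cases vy : v = y
      · subst vy; simp [*, Ne.symm]
      by_cases vz : v = z
      · subst vz; simp [*, Ne.symm]
      simp [*, Ne.symm]
    simp [*]
  · rw [hdiag]
    by_cases ux : u = x
    · subst ux; simp [*]
    by_cases uw : u = w
    · subst uw; simp [*, Ne.symm]
    simp [*]

theorem adjM_switch {n : ℕ} {G : SimpleGraph (Fin n)} {x y z w : Fin n}
    (h : Switchable G x y z w) :
    adjM (switch G x y z w) = adjM G + switchMat x y z w := by
  ext u v
  obtain ⟨h1, h2⟩ := adjM_add_switchMat h u v
  have hs : (adjM G + switchMat x y z w) v u = (adjM G + switchMat x y z w) u v := by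
    rw [Matrix.add_apply, Matrix.add_apply, adjM_symm, switchMat_symm]
  have hiff : (switch G x y z w).Adj u v ↔ (adjM G + switchMat x y z w) u v = 1 := by
    rw [switch, SimpleGraph.fromRel_adj, hs, or_self]
    refine ⟨fun h => h.2, fun h => ⟨?_, h⟩⟩
    rintro rfl
    rw [h2] at h
    exact zero_ne_one h
  by_cases h3 : (switch G x y z w).Adj u v
  · rw [hiff.1 h3, adjM, if_pos h3]
  · rw [adjM, if_neg h3]
    rw [hiff] at h3
    exact (h1.resolve_right h3).symm

theorem adjM_injective {n : ℕ} : Function.Injective (adjM (n := n)) := by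
  intro G H h
  ext u v
  have := congrFun (congrFun h u) v
  unfold adjM at this
  by_cases h1 : G.Adj u v <;> by_cases h2 : H.Adj u v <;> simp_all

theorem adjM_eq_one {n : ℕ} {G : SimpleGraph (Fin n)} {u v : Fin n} :
    adjM G u v = 1 ↔ G.Adj u v := by
  unfold adjM
  split_ifs with h <;> simp [h]

theorem sum_switchMat {n : ℕ} (x y z w u : Fin n) : ∑ v, switchMat x y z w u v = 0 := by
  simp [switchMat_apply, Finset.sum_add_distrib, ← Finset.mul_sum]

theorem deg_switch {n : ℕ} {G : SimpleGraph (Fin n)} {x y z w : Fin n}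
    (h : Switchable G x y z w) (u : Fin n) : deg (switch G x y z w) u = deg G u := by
  have : (deg (switch G x y z w) u : ℝ) = deg G u := by
    rw [← sum_adjM, ← sum_adjM, adjM_switch h]
    simp [Finset.sum_add_distrib, sum_switchMat]
  exact_mod_cast this

theorem switchable_switch {n : ℕ} {G : SimpleGraph (Fin n)} {x y z w : Fin n}
    (h : Switchable G x y z w) : Switchable (switch G x y z w) x z y w := by
  have h0 := h
  obtain ⟨hxy, hzw, ⟨hxz, hnxz⟩, hyw, hnyw⟩ := h
  have nxy := hxy.ne
  have nzw := hzw.ne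
  have nxw : x ≠ w := by rintro rfl; exact hnxz hzw.symm
  have nyz : y ≠ z := by rintro rfl; exact hnxz hxy
  have hadj : ∀ u v, (switch G x y z w).Adj u v ↔ (adjM G + switchMat x y z w) u v = 1 := by
    intro u v
    rw [← adjM_eq_one, adjM_switch h0]
  simp only [Switchable, hadj, Matrix.add_apply, switchMat_apply]
  simp [*, Ne.symm, adjM]

theorem switch_switch {n : ℕ} {G : SimpleGraph (Fin n)} {x y z w : Fin n}
    (h : Switchable G x y z w) : switch (switch G x y z w) x z y w = G := by
  apply adjM_injective
  rw [adjM_switch (switchable_switch h), adjM_switch h, switchMat_swap]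
  simp

theorem sum_switch {n : ℕ} (d : Fin n → ℕ) (F : SimpleGraph (Fin n) → ℝ) :
    ∑ G ∈ degFinset n d, ∑ x, ∑ y, ∑ z, ∑ w,
      (if Switchable G x y z w then F (switch G x y z w) - F G else 0) = 0 := by
  have e : ∀ H : SimpleGraph (Fin n) → Fin n → Fin n → Fin n → Fin n → ℝ,
      ∑ G ∈ degFinset n d, ∑ x, ∑ y, ∑ z, ∑ w,
        (if Switchable G x y z w then H G x y z w else 0) =
      ∑ q ∈ (degFinset n d ×ˢ (Finset.univ : Finset (Fin n × Fin n × Fin n × Fin n))).filter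
        (fun q => Switchable q.1 q.2.1 q.2.2.1 q.2.2.2.1 q.2.2.2.2),
        H q.1 q.2.1 q.2.2.1 q.2.2.2.1 q.2.2.2.2 := by
    intro H
    rw [Finset.sum_filter, Finset.sum_product]
    simp only [Fintype.sum_prod_type]
  rw [e, Finset.sum_sub_distrib, sub_eq_zero]
  refine Finset.sum_nbij' (fun q => (switch q.1 q.2.1 q.2.2.1 q.2.2.2.1 q.2.2.2.2,
      q.2.1, q.2.2.2.1, q.2.2.1, q.2.2.2.2))
    (fun q => (switch q.1 q.2.1 q.2.2.1 q.2.2.2.1 q.2.2.2.2,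
      q.2.1, q.2.2.2.1, q.2.2.1, q.2.2.2.2)) ?_ ?_ ?_ ?_ ?_
  all_goals
    rintro ⟨G, x, y, z, w⟩ hq
    simp only [Finset.mem_filter, Finset.mem_product, Finset.mem_univ, and_true, degFinset,
      true_and] at hq ⊢
  · exact ⟨fun j => (deg_switch hq.2 j).trans (hq.1 j), switchable_switch hq.2⟩
  · exact ⟨fun j => (deg_switch hq.2 j).trans (hq.1 j), switchable_switch hq.2⟩
  · rw [switch_switch hq.2]
  · rw [switch_switch hq.2]

/-- The entrywise inner product of two matrices. -/
noncomputable def frobInner {n : ℕ} (M N : Matrix (Fin n) (Fin n) ℝ) : ℝ :=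
  ∑ i, ∑ j, M i j * N i j

theorem frobInner_eq_trace {n : ℕ} (M N : Matrix (Fin n) (Fin n) ℝ) :
    frobInner M N = (M.transpose * N).trace := by
  simp only [frobInner, Matrix.trace, Matrix.diag_apply, Matrix.mul_apply, Matrix.transpose_apply]
  exact Finset.sum_comm

theorem frobSq_eq_frobInner {n : ℕ} (M : Matrix (Fin n) (Fin n) ℝ) :
    frobSq M = frobInner M M := by
  simp [frobSq, frobInner, sq]

theorem frobSq_add {n : ℕ} (M N : Matrix (Fin n) (Fin n) ℝ) :
    frobSq (M + N) = frobSq M + 2 * frobInner M N + frobSq N := by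
  simp only [frobSq, frobInner, Finset.mul_sum, ← Finset.sum_add_distrib, Matrix.add_apply]
  exact Finset.sum_congr rfl fun i _ => Finset.sum_congr rfl fun j _ => by ring

theorem frobSq_add_le {n : ℕ} (M N : Matrix (Fin n) (Fin n) ℝ) :
    frobSq (M + N) ≤ 2 * frobSq M + 2 * frobSq N := by
  simp only [frobSq, Finset.mul_sum, ← Finset.sum_add_distrib, Matrix.add_apply]
  exact Finset.sum_le_sum fun i _ => Finset.sum_le_sum fun j _ => by
    nlinarith [sq_nonneg (M i j - N i j)]

theorem frobInner_add_right {n : ℕ} (M N P : Matrix (Fin n) (Fin n) ℝ) :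
    frobInner M (N + P) = frobInner M N + frobInner M P := by
  simp [frobInner, mul_add, Finset.sum_add_distrib]

theorem frobInner_smul_right {n : ℕ} (c : ℝ) (M N : Matrix (Fin n) (Fin n) ℝ) :
    frobInner M (c • N) = c * frobInner M N := by
  simp only [frobInner, Matrix.smul_apply, smul_eq_mul, Finset.mul_sum]
  exact Finset.sum_congr rfl fun i _ => Finset.sum_congr rfl fun j _ => by ring

theorem frobInner_le {n : ℕ} (M N : Matrix (Fin n) (Fin n) ℝ) :
    frobInner M N ≤ frobSq M + frobSq N / 4 := by
  simp only [frobInner, frobSq, Finset.sum_div, ← Finset.sum_add_distrib]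
  exact Finset.sum_le_sum fun i _ => Finset.sum_le_sum fun j _ => by
    nlinarith [sq_nonneg (M i j - N i j / 2)]

open Matrix in
theorem frobSq_sq_add_le {n : ℕ} {B E : Matrix (Fin n) (Fin n) ℝ} (hB : Bᵀ = B) (hE : Eᵀ = E) :
    frobSq ((B + E) * (B + E)) ≤ frobSq (B * B) + 4 * frobInner (B * B * B) E +
      10 * frobSq (B * E) + 2 * frobSq (E * E) := by
  have e0 : (B + E) * (B + E) = B * B + ((B * E + E * B) + E * E) := by noncomm_ring
  have t1 : frobInner (B * B) (B * E) = frobInner (B * B * B) E := by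
    simp only [frobInner_eq_trace, transpose_mul, hB, Matrix.mul_assoc]
  have t2 : frobInner (B * B) (E * B) = frobInner (B * B * B) E := by
    simp only [frobInner_eq_trace, transpose_mul, hB]
    rw [← Matrix.mul_assoc, trace_mul_comm]
    simp only [Matrix.mul_assoc]
  have t3 : frobInner (B * B) (E * E) = frobSq (B * E) := by
    rw [frobSq_eq_frobInner]
    simp only [frobInner_eq_trace, transpose_mul, hB, hE, Matrix.mul_assoc]
    rw [trace_mul_comm E]
    simp only [Matrix.mul_assoc]
  have t4 : frobSq (E * B) = frobSq (B * E) := by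
    have : E * B = (B * E)ᵀ := by rw [transpose_mul, hB, hE]
    rw [this, frobSq, frobSq, Finset.sum_comm]
    rfl
  have h1 := frobSq_add_le (B * E + E * B) (E * E)
  have h2 := frobSq_add_le (B * E) (E * B)
  rw [e0, frobSq_add, frobInner_add_right, frobInner_add_right, t1, t2, t3]
  linarith

theorem frobSq_mul_switchMat_le {n : ℕ} {M : Matrix (Fin n) (Fin n) ℝ} {c : ℝ}
    (hM : ∀ i j, |M i j| ≤ c) (x y z w : Fin n) :
    frobSq (M * switchMat x y z w) ≤ 32 * c ^ 2 * n := by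
  have hc : 0 ≤ c := (abs_nonneg _).trans (hM x y)
  have hent : ∀ i j, (M * switchMat x y z w) i j =
      (M i x - M i w) * ((if j = z then 1 else 0) - (if j = y then 1 else 0)) +
      (M i z - M i y) * ((if j = x then 1 else 0) - (if j = w then 1 else 0)) := by
    intro i j
    simp only [Matrix.mul_apply, switchMat_apply]
    simp [mul_add, Finset.sum_add_distrib, mul_sub]
  have hsq : ∀ i a b, (M i a - M i b) ^ 2 ≤ 4 * c ^ 2 := by
    intro i a b
    have h1 := abs_le.1 (hM i a)
    have h2 := abs_le.1 (hM i b)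
    nlinarith
  have hrow : ∀ i, ∑ j, (M * switchMat x y z w) i j ^ 2 ≤ 32 * c ^ 2 := by
    intro i
    calc ∑ j, (M * switchMat x y z w) i j ^ 2
        ≤ ∑ j, 8 * c ^ 2 * ((if j = z then 1 else 0) + (if j = y then 1 else 0) +
            (if j = x then 1 else 0) + (if j = w then 1 else 0)) := by
          refine Finset.sum_le_sum fun j _ => ?_
          rw [hent]
          have hpq : ∀ s t : ℝ, (s + t) ^ 2 ≤ 2 * s ^ 2 + 2 * t ^ 2 := fun s t => by
            nlinarith [sq_nonneg (s - t)]
          have hd : ∀ a b : Fin n, ((if j = a then (1 : ℝ) else 0) - (if j = b then 1 else 0)) ^ 2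
              ≤ (if j = a then 1 else 0) + (if j = b then 1 else 0) := by
            intro a b
            split_ifs <;> norm_num
          refine (hpq _ _).trans ?_
          rw [mul_pow, mul_pow]
          have h1 := mul_le_mul (hsq i x w) (hd z y) (sq_nonneg _) (by positivity)
          have h2 := mul_le_mul (hsq i z y) (hd x w) (sq_nonneg _) (by positivity)
          linarith
      _ = 32 * c ^ 2 := by
          rw [← Finset.mul_sum]
          simp [Finset.sum_add_distrib]
          ring
  calc frobSq (M * switchMat x y z w) ≤ ∑ _i : Fin n, 32 * c ^ 2 :=
        Finset.sum_le_sum fun i _ => hrow i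
    _ = 32 * c ^ 2 * n := by simp; ring

theorem frobSq_switch_le {n : ℕ} {B : Matrix (Fin n) (Fin n) ℝ} (hB : B.transpose = B)
    (hB1 : ∀ i j, |B i j| ≤ 1) (x y z w : Fin n) :
    frobSq ((B + switchMat x y z w) * (B + switchMat x y z w)) - frobSq (B * B) ≤
      4 * frobInner (B * B * B) (switchMat x y z w) + 576 * n := by
  have hE : (switchMat x y z w).transpose = switchMat x y z w := by
    ext u v
    exact switchMat_symm x y z w v u
  have h := frobSq_sq_add_le hB hE
  have h1 := frobSq_mul_switchMat_le hB1 x y z w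
  have h2 := frobSq_mul_switchMat_le (M := switchMat x y z w) (c := 2) (by
    intro i j
    rw [switchMat_apply]
    split_ifs <;> norm_num) x y z w
  linarith

theorem frobInner_switchMat {n : ℕ} {X : Matrix (Fin n) (Fin n) ℝ} (hX : X.transpose = X)
    (x y z w : Fin n) :
    frobInner X (switchMat x y z w) = 2 * (X x z + X w y - X x y - X w z) := by
  have hs : ∀ u v, X u v = X v u := fun u v => congrFun (congrFun hX v) u
  simp only [frobInner, switchMat_apply]
  simp [mul_add, Finset.sum_add_distrib, mul_sub]
  rw [hs z x, hs z w, hs y x, hs y w]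
  ring

/-- The adjacency matrix of the complement. -/
noncomputable def coadjM {n : ℕ} (G : SimpleGraph (Fin n)) : Matrix (Fin n) (Fin n) ℝ :=
  (Matrix.of fun _ _ => 1) - 1 - adjM G

theorem coadjM_apply {n : ℕ} (G : SimpleGraph (Fin n)) (i j : Fin n) :
    coadjM G i j = if i ≠ j ∧ ¬ G.Adj i j then 1 else 0 := by
  simp only [coadjM, adjM, Matrix.sub_apply, Matrix.of_apply, Matrix.one_apply]
  by_cases h : i = j
  · subst h; simp
  · by_cases h' : G.Adj i j <;> simp [h, h']

theorem coadjM_symm {n : ℕ} (G : SimpleGraph (Fin n)) (i j : Fin n) :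
    coadjM G i j = coadjM G j i := by
  simp [coadjM_apply, G.adj_comm, ne_comm]

theorem sum_four_reverse {n : ℕ} (g : Fin n → Fin n → Fin n → Fin n → ℝ) :
    ∑ x, ∑ y, ∑ z, ∑ w, g x y z w = ∑ x, ∑ y, ∑ z, ∑ w, g w z y x := by
  have e : ∀ g : Fin n → Fin n → Fin n → Fin n → ℝ, ∑ x, ∑ y, ∑ z, ∑ w, g x y z w =
      ∑ t : Fin n × Fin n × Fin n × Fin n, g t.1 t.2.1 t.2.2.1 t.2.2.2 := by
    intro g
    simp only [Fintype.sum_prod_type]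
  rw [e, e]
  exact Finset.sum_nbij' (fun t => (t.2.2.2, t.2.2.1, t.2.1, t.1))
    (fun t => (t.2.2.2, t.2.2.1, t.2.1, t.1)) (by simp) (by simp) (by simp) (by simp) (by simp)

theorem switchable_indicator {n : ℕ} (G : SimpleGraph (Fin n)) (x y z w : Fin n) :
    (if Switchable G x y z w then (1 : ℝ) else 0) =
      adjM G x y * adjM G z w * coadjM G x z * coadjM G y w := by
  simp only [coadjM_apply, adjM, Switchable]
  by_cases h1 : G.Adj x y <;> by_cases h2 : G.Adj z w <;>
    by_cases h3 : x = z <;> by_cases h4 : G.Adj x z <;> by_cases h5 : y = w <;>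
    by_cases h6 : G.Adj y w <;> simp [*]

open Matrix in
theorem sum_switchable_frobInner {n : ℕ} (G : SimpleGraph (Fin n))
    {X : Matrix (Fin n) (Fin n) ℝ} (hX : Xᵀ = X) :
    ∑ x, ∑ y, ∑ z, ∑ w, (if Switchable G x y z w then (1 : ℝ) else 0) *
        frobInner X (switchMat x y z w) =
      4 * frobInner X (of fun u v => coadjM G u v * (adjM G * coadjM G * adjM G) u v -
        adjM G u v * (coadjM G * adjM G * coadjM G) u v) := by
  set W : Fin n → Fin n → Fin n → Fin n → ℝ := fun x y z w =>
    adjM G x y * adjM G z w * coadjM G x z * coadjM G y w with hW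
  have hWs : ∀ x y z w, W w z y x = W x y z w := by
    intro x y z w
    simp only [hW]
    rw [adjM_symm G w z, adjM_symm G y x, coadjM_symm G w y, coadjM_symm G z x]
    ring
  have r1 : ∑ x, ∑ y, ∑ z, ∑ w, W x y z w * X w y = ∑ x, ∑ y, ∑ z, ∑ w, W x y z w * X x z := by
    rw [sum_four_reverse]
    simp only [hWs]
  have r2 : ∑ x, ∑ y, ∑ z, ∑ w, W x y z w * X w z = ∑ x, ∑ y, ∑ z, ∑ w, W x y z w * X x y := by
    rw [sum_four_reverse]
    simp only [hWs]
  have s1 : ∑ x, ∑ y, ∑ z, ∑ w, W x y z w * X x z =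
      ∑ u, ∑ v, X u v * (coadjM G u v * (adjM G * coadjM G * adjM G) u v) := by
    refine Finset.sum_congr rfl fun x _ => ?_
    rw [Finset.sum_comm]
    refine Finset.sum_congr rfl fun z _ => ?_
    rw [Finset.sum_comm]
    simp only [mul_apply, Finset.sum_mul, Finset.mul_sum]
    refine Finset.sum_congr rfl fun w _ => Finset.sum_congr rfl fun y _ => ?_
    simp only [hW]
    rw [adjM_symm G w z]
    ring
  have s2 : ∑ x, ∑ y, ∑ z, ∑ w, W x y z w * X x y =
      ∑ u, ∑ v, X u v * (adjM G u v * (coadjM G * adjM G * coadjM G) u v) := by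
    refine Finset.sum_congr rfl fun x _ => Finset.sum_congr rfl fun y _ => ?_
    rw [Finset.sum_comm]
    simp only [mul_apply, Finset.sum_mul, Finset.mul_sum]
    refine Finset.sum_congr rfl fun w _ => Finset.sum_congr rfl fun z _ => ?_
    simp only [hW]
    rw [coadjM_symm G y w]
    ring
  simp only [switchable_indicator, frobInner_switchMat hX]
  have e : ∀ x y z w, W x y z w * (2 * (X x z + X w y - X x y - X w z)) =
      2 * (W x y z w * X x z) + 2 * (W x y z w * X w y) - 2 * (W x y z w * X x y) -
        2 * (W x y z w * X w z) := fun x y z w => by ring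
  simp only [hW] at e r1 r2 s1 s2
  simp only [e, Finset.sum_sub_distrib, Finset.sum_add_distrib, ← Finset.mul_sum]
  rw [r1, r2, s1, s2]
  simp only [frobInner, of_apply, mul_sub, Finset.sum_sub_distrib]
  ring

/-- The adjacency matrix centred by the constant matrix with entries `ρ`. -/
noncomputable def devM {n : ℕ} (G : SimpleGraph (Fin n)) (ρ : ℝ) : Matrix (Fin n) (Fin n) ℝ :=
  adjM G - ρ • Matrix.of fun _ _ => 1

theorem devM_apply {n : ℕ} (G : SimpleGraph (Fin n)) (ρ : ℝ) (i j : Fin n) :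
    devM G ρ i j = adjM G i j - ρ := by
  simp [devM]

theorem devM_transpose {n : ℕ} (G : SimpleGraph (Fin n)) (ρ : ℝ) :
    (devM G ρ).transpose = devM G ρ := by
  ext i j
  rw [Matrix.transpose_apply, devM_apply, devM_apply, adjM_symm]

theorem adjM_nonneg {n : ℕ} (G : SimpleGraph (Fin n)) (i j : Fin n) : 0 ≤ adjM G i j := by
  unfold adjM
  split_ifs <;> norm_num

theorem adjM_le_one {n : ℕ} (G : SimpleGraph (Fin n)) (i j : Fin n) : adjM G i j ≤ 1 := by
  unfold adjM
  split_ifs <;> norm_num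

theorem abs_devM_le {n : ℕ} (G : SimpleGraph (Fin n)) {ρ : ℝ} (h0 : 0 ≤ ρ) (h1 : ρ ≤ 1)
    (i j : Fin n) : |devM G ρ i j| ≤ 1 := by
  rw [devM_apply, abs_le]
  have := adjM_nonneg G i j
  have := adjM_le_one G i j
  constructor <;> linarith

theorem abs_mul_apply_le {n : ℕ} {M N : Matrix (Fin n) (Fin n) ℝ} {a b : ℝ}
    (hM : ∀ i j, |M i j| ≤ a) (hN : ∀ i j, |N i j| ≤ b) (i j : Fin n) :
    |(M * N) i j| ≤ n * (a * b) := by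
  rw [Matrix.mul_apply]
  calc |∑ k, M i k * N k j| ≤ ∑ k, |M i k * N k j| := Finset.abs_sum_le_sum_abs _ _
    _ ≤ ∑ _k : Fin n, a * b := Finset.sum_le_sum fun k _ => by
        rw [abs_mul]
        exact mul_le_mul (hM i k) (hN k j) (abs_nonneg _) ((abs_nonneg _).trans (hM i k))
    _ = n * (a * b) := by simp

theorem deg_le {n : ℕ} (G : SimpleGraph (Fin n)) (u : Fin n) : (deg G u : ℝ) ≤ n := by
  rw [← sum_adjM]
  calc ∑ j, adjM G u j ≤ ∑ _j : Fin n, (1 : ℝ) := Finset.sum_le_sum fun j _ => adjM_le_one G u j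
    _ = n := by simp

open Matrix in
theorem devM_cube_apply {n : ℕ} (G : SimpleGraph (Fin n)) (ρ : ℝ) (u v : Fin n) :
    (devM G ρ * devM G ρ * devM G ρ) u v = (adjM G * adjM G * adjM G) u v -
      ρ * (∑ k, adjM G u k * deg G k + deg G u * deg G v + ∑ k, adjM G v k * deg G k) +
      ρ ^ 2 * (n * deg G u + n * deg G v + ∑ k, (deg G k : ℝ)) - ρ ^ 3 * n ^ 2 := by
  set J : Matrix (Fin n) (Fin n) ℝ := of fun _ _ => 1 with hJ
  set A := adjM G with hA
  have hJ1 : ∀ i j, J i j = 1 := fun _ _ => rfl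
  have e : devM G ρ * devM G ρ * devM G ρ = A * A * A - ρ • (A * (A * J) + A * J * A +
      (J * A) * A) + ρ ^ 2 • (A * J * J + J * A * J + J * (J * A)) - ρ ^ 3 • (J * J * J) := by
    simp only [devM, ← hA, ← hJ, sub_mul, mul_sub, smul_mul_assoc, mul_smul_comm, smul_add,
      smul_sub, smul_smul, mul_assoc]
    module
  have hAJ : ∀ i j, (A * J) i j = deg G i := fun i j => by
    rw [← sum_adjM]; simp [mul_apply, hJ]; rfl
  have hJA : ∀ i j, (J * A) i j = deg G j := fun i j => by
    rw [← sum_adjM]; simp only [mul_apply, hJ, of_apply, one_mul]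
    exact Finset.sum_congr rfl fun k _ => adjM_symm G k j
  have hs : ∀ k, A k v = A v k := fun k => adjM_symm G k v
  have t1 : (A * (A * J)) u v = ∑ k, A u k * deg G k := by
    rw [mul_apply]; simp only [hAJ]
  have t2 : (A * J * A) u v = deg G u * deg G v := by
    rw [mul_apply]; simp only [hAJ, ← Finset.mul_sum, hs]; rw [hA, sum_adjM]
  have t3 : (J * A * A) u v = ∑ k, A v k * deg G k := by
    rw [mul_apply]; simp only [hJA, hs, mul_comm]
  have t4 : (A * J * J) u v = n * deg G u := by
    rw [mul_apply]; simp [hAJ, hJ1]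
  have t5 : (J * A * J) u v = ∑ k, (deg G k : ℝ) := by
    rw [mul_apply]; simp [hJA, hJ1]
  have t6 : (J * (J * A)) u v = n * deg G v := by
    rw [mul_apply]; simp [hJA, hJ1]
  have t7 : (J * J * J) u v = n ^ 2 := by
    rw [mul_apply]; simp [mul_apply, hJ]; ring
  rw [e]
  simp only [Matrix.sub_apply, Matrix.add_apply, Matrix.smul_apply, smul_eq_mul, t1, t2, t3, t4,
    t5, t6, t7]
  ring

open Matrix in
theorem adjM_mul_coadjM_mul_adjM_apply {n : ℕ} (G : SimpleGraph (Fin n)) (u v : Fin n) :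
    (adjM G * coadjM G * adjM G) u v =
      deg G u * deg G v - (adjM G * adjM G) u v - (adjM G * adjM G * adjM G) u v := by
  set J : Matrix (Fin n) (Fin n) ℝ := of fun _ _ => 1 with hJ
  set A := adjM G with hA
  have e : A * coadjM G * A = A * J * A - A * A - A * A * A := by
    rw [coadjM, ← hA, ← hJ]
    noncomm_ring
  have hAJ : ∀ i j, (A * J) i j = deg G i := fun i j => by
    rw [← sum_adjM]; simp [mul_apply, hJ]; rfl
  have hs : ∀ k, A k v = A v k := fun k => adjM_symm G k v
  have t2 : (A * J * A) u v = deg G u * deg G v := by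
    rw [mul_apply]; simp only [hAJ, ← Finset.mul_sum, hs]; rw [hA, sum_adjM]
  rw [e, Matrix.sub_apply, Matrix.sub_apply, t2]

open Matrix in
theorem coadjM_mul_adjM_mul_coadjM_apply {n : ℕ} (G : SimpleGraph (Fin n)) (u v : Fin n) :
    (coadjM G * adjM G * coadjM G) u v =
      ∑ k, (deg G k : ℝ) - deg G u - deg G v - ∑ k, adjM G u k * deg G k -
        ∑ k, adjM G v k * deg G k + adjM G u v + 2 * (adjM G * adjM G) u v +
        (adjM G * adjM G * adjM G) u v := by
  set J : Matrix (Fin n) (Fin n) ℝ := of fun _ _ => 1 with hJ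
  set A := adjM G with hA
  have hJ1 : ∀ i j, J i j = 1 := fun _ _ => rfl
  have e : coadjM G * A * coadjM G = J * A * J - J * A - J * A * A - A * J - A * (A * J) + A +
      (A * A + A * A) + A * A * A := by
    rw [coadjM, ← hA, ← hJ]
    noncomm_ring
  have hAJ : ∀ i j, (A * J) i j = deg G i := fun i j => by
    rw [← sum_adjM]; simp [mul_apply, hJ]; rfl
  have hJA : ∀ i j, (J * A) i j = deg G j := fun i j => by
    rw [← sum_adjM]; simp only [mul_apply, hJ, of_apply, one_mul]
    exact Finset.sum_congr rfl fun k _ => adjM_symm G k j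
  have hs : ∀ k, A k v = A v k := fun k => adjM_symm G k v
  have t1 : (A * (A * J)) u v = ∑ k, A u k * deg G k := by
    rw [mul_apply]; simp only [hAJ]
  have t3 : (J * A * A) u v = ∑ k, A v k * deg G k := by
    rw [mul_apply]; simp only [hJA, hs, mul_comm]
  have t5 : (J * A * J) u v = ∑ k, (deg G k : ℝ) := by
    rw [mul_apply]; simp [hJA, hJ1]
  rw [e]
  simp only [Matrix.sub_apply, Matrix.add_apply, t1, t3, t5, hAJ, hJA]
  ring

theorem abs_sum_adjM_mul_deg_sub_le {n : ℕ} (G : SimpleGraph (Fin n)) {D δ : ℝ} (hD0 : 0 ≤ D)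
    (hDn : D ≤ n) (hδ : ∀ u, |(deg G u : ℝ) - D| ≤ δ) (u : Fin n) :
    |∑ k, adjM G u k * deg G k - D ^ 2| ≤ 2 * n * δ := by
  have hδ0 : 0 ≤ δ := (abs_nonneg _).trans (hδ u)
  have e : ∑ k, adjM G u k * deg G k - D ^ 2 =
      ∑ k, adjM G u k * (deg G k - D) + D * (deg G u - D) := by
    rw [← sum_adjM G u]
    simp only [mul_sub, Finset.sum_sub_distrib, ← Finset.sum_mul]
    ring
  have h1 : |∑ k, adjM G u k * (deg G k - D)| ≤ n * δ := by
    calc |∑ k, adjM G u k * (deg G k - D)| ≤ ∑ k, |adjM G u k * (deg G k - D)| :=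
          Finset.abs_sum_le_sum_abs _ _
      _ ≤ ∑ _k : Fin n, δ := Finset.sum_le_sum fun k _ => by
          rw [abs_mul, abs_of_nonneg (adjM_nonneg G u k)]
          exact (mul_le_of_le_one_left (abs_nonneg _) (adjM_le_one G u k)).trans (hδ k)
      _ = n * δ := by simp
  have h2 : |D * (deg G u - D)| ≤ n * δ := by
    rw [abs_mul, abs_of_nonneg hD0]
    exact mul_le_mul hDn (hδ u) (abs_nonneg _) (hD0.trans hDn)
  rw [e]
  have := abs_add_le (∑ k, adjM G u k * (deg G k - D)) (D * (deg G u - D))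
  linarith

theorem abs_deg_mul_deg_sub_le {n : ℕ} (G : SimpleGraph (Fin n)) {D δ : ℝ} (hD0 : 0 ≤ D)
    (hDn : D ≤ n) (hδ : ∀ u, |(deg G u : ℝ) - D| ≤ δ) (u v : Fin n) :
    |(deg G u : ℝ) * deg G v - D ^ 2| ≤ 2 * n * δ := by
  have e : (deg G u : ℝ) * deg G v - D ^ 2 = deg G u * (deg G v - D) + D * (deg G u - D) := by
    ring
  have h1 : |(deg G u : ℝ) * (deg G v - D)| ≤ n * δ := by
    rw [abs_mul, abs_of_nonneg (Nat.cast_nonneg _)]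
    exact mul_le_mul (deg_le G u) (hδ v) (abs_nonneg _) (hD0.trans hDn)
  have h2 : |D * (deg G u - D)| ≤ n * δ := by
    rw [abs_mul, abs_of_nonneg hD0]
    exact mul_le_mul hDn (hδ u) (abs_nonneg _) (hD0.trans hDn)
  rw [e]
  have := abs_add_le ((deg G u : ℝ) * (deg G v - D)) (D * (deg G u - D))
  linarith

/-- The error in approximating the switching drift by a function of the centred matrix. -/
noncomputable def driftErr {n : ℕ} (G : SimpleGraph (Fin n)) (ρ : ℝ) : Matrix (Fin n) (Fin n) ℝ :=
  (Matrix.of fun u v => coadjM G u v * (adjM G * coadjM G * adjM G) u v -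
    adjM G u v * (coadjM G * adjM G * coadjM G) u v) +
  (devM G ρ * devM G ρ * devM G ρ + ((n : ℝ) ^ 2 * ρ * (1 - ρ)) • devM G ρ)

theorem abs_driftErr_le {n : ℕ} (G : SimpleGraph (Fin n)) {ρ δ : ℝ} (h0 : 0 ≤ ρ) (h1 : ρ ≤ 1)
    (hsum : ∑ k, (deg G k : ℝ) = n * (ρ * n)) (hδ : ∀ u, |(deg G u : ℝ) - ρ * n| ≤ δ)
    {u v : Fin n} (huv : u ≠ v) : |driftErr G ρ u v| ≤ 16 * n * δ + 6 * n := by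
  have hn1 : (1 : ℝ) ≤ n := by exact_mod_cast u.pos
  have hD0 : 0 ≤ ρ * n := by positivity
  have hDn : ρ * n ≤ n := by nlinarith
  have hδ0 : 0 ≤ δ := (abs_nonneg _).trans (hδ u)
  have a1 := abs_sum_adjM_mul_deg_sub_le G hD0 hDn hδ u
  have a2 := abs_sum_adjM_mul_deg_sub_le G hD0 hDn hδ v
  have a3 := abs_deg_mul_deg_sub_le G hD0 hDn hδ u v
  have a4 : |(adjM G * adjM G) u v| ≤ n := by
    have := abs_mul_apply_le (M := adjM G) (N := adjM G) (a := 1) (b := 1)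
      (fun i j => by rw [abs_of_nonneg (adjM_nonneg G i j)]; exact adjM_le_one G i j)
      (fun i j => by rw [abs_of_nonneg (adjM_nonneg G i j)]; exact adjM_le_one G i j) u v
    simpa using this
  have b1 := hδ u
  have b2 := hδ v
  have dn1 := deg_le G u
  have dn2 := deg_le G v
  have dp1 : (0 : ℝ) ≤ deg G u := Nat.cast_nonneg _
  have dp2 : (0 : ℝ) ≤ deg G v := Nat.cast_nonneg _
  simp only [driftErr, Matrix.add_apply, Matrix.of_apply, Matrix.smul_apply, smul_eq_mul,
    devM_cube_apply, devM_apply, adjM_mul_coadjM_mul_adjM_apply, coadjM_mul_adjM_mul_coadjM_apply,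
    hsum]
  set s := ∑ k, adjM G u k * deg G k
  set t := ∑ k, adjM G v k * deg G k
  set p := (deg G u : ℝ) * deg G v
  set x := (deg G u : ℝ)
  set y := (deg G v : ℝ)
  set q := (adjM G * adjM G) u v
  set r := (adjM G * adjM G * adjM G) u v
  have c1 : |ρ * ((s - (ρ * n) ^ 2) + (p - (ρ * n) ^ 2) + (t - (ρ * n) ^ 2))| ≤ 6 * n * δ := by
    rw [abs_mul, abs_of_nonneg h0]
    refine (mul_le_of_le_one_left (abs_nonneg _) h1).trans ?_
    have := abs_add_three (s - (ρ * n) ^ 2) (p - (ρ * n) ^ 2) (t - (ρ * n) ^ 2)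
    linarith
  have c2 : |ρ ^ 2 * (n * ((x - ρ * n) + (y - ρ * n)))| ≤ 2 * n * δ := by
    rw [abs_mul, abs_of_nonneg (sq_nonneg ρ)]
    refine (mul_le_of_le_one_left (abs_nonneg _) (pow_le_one₀ h0 h1)).trans ?_
    rw [abs_mul, abs_of_nonneg (by linarith : (0 : ℝ) ≤ n)]
    have h3 := abs_add_le (x - ρ * n) (y - ρ * n)
    have := mul_le_mul_of_nonneg_left (h3.trans (add_le_add b1 b2)) (by linarith : (0 : ℝ) ≤ n)
    linarith
  have hnδ : 0 ≤ n * δ := by positivity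
  rw [abs_le] at a1 a2 a3 a4 b1 b2 c1 c2
  by_cases hadj : G.Adj u v
  · have e1 : adjM G u v = 1 := adjM_eq_one.2 hadj
    have e2 : coadjM G u v = 0 := by simp [coadjM_apply, hadj]
    rw [e1, e2, abs_le]
    constructor <;> linarith
  · have e1 : adjM G u v = 0 := by simp [adjM, hadj]
    have e2 : coadjM G u v = 1 := by simp [coadjM_apply, hadj, huv]
    rw [e1, e2, abs_le]
    constructor <;> linarith

theorem abs_driftErr_self_le {n : ℕ} (G : SimpleGraph (Fin n)) {ρ : ℝ} (h0 : 0 ≤ ρ) (h1 : ρ ≤ 1)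
    (u : Fin n) : |driftErr G ρ u u| ≤ 2 * (n : ℝ) ^ 2 := by
  have hB := abs_devM_le G h0 h1
  have h3 := abs_mul_apply_le (abs_mul_apply_le hB hB) hB u u
  have e1 : adjM G u u = 0 := by simp [adjM]
  have e2 : coadjM G u u = 0 := by simp [coadjM_apply]
  simp only [driftErr, Matrix.add_apply, Matrix.of_apply, Matrix.smul_apply, smul_eq_mul,
    devM_apply, e1, e2]
  have h4 : ρ * (1 - ρ) * ρ ≤ 1 := by
    have : ρ * (1 - ρ) ≤ 1 := by nlinarith
    exact mul_le_one₀ this h0 h1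
  have h5 : 0 ≤ ρ * (1 - ρ) * ρ := mul_nonneg (mul_nonneg h0 (by linarith)) h0
  have h6 : (0 : ℝ) ≤ (n : ℝ) ^ 2 := sq_nonneg _
  have h7 := mul_le_mul_of_nonneg_left h4 h6
  have h8 := mul_nonneg h6 h5
  rw [abs_le] at h3 ⊢
  constructor <;> linarith

theorem frobSq_driftErr_le {n : ℕ} (G : SimpleGraph (Fin n)) {ρ δ : ℝ} (h0 : 0 ≤ ρ) (h1 : ρ ≤ 1)
    (hsum : ∑ k, (deg G k : ℝ) = n * (ρ * n)) (hδ : ∀ u, |(deg G u : ℝ) - ρ * n| ≤ δ) :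
    frobSq (driftErr G ρ) ≤ n ^ 2 * (16 * n * δ + 6 * n) ^ 2 + 4 * n ^ 5 := by
  have h : ∀ i j, driftErr G ρ i j ^ 2 ≤
      (16 * n * δ + 6 * n) ^ 2 + if i = j then 4 * (n : ℝ) ^ 4 else 0 := by
    intro i j
    rw [← sq_abs]
    split_ifs with hij
    · subst hij
      have := pow_le_pow_left₀ (abs_nonneg _) (abs_driftErr_self_le G h0 h1 i) 2
      nlinarith [sq_nonneg (16 * n * δ + 6 * n)]
    · rw [add_zero]
      exact pow_le_pow_left₀ (abs_nonneg _) (abs_driftErr_le G h0 h1 hsum hδ hij) 2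
  calc frobSq (driftErr G ρ) ≤ ∑ i : Fin n, ∑ j : Fin n,
        ((16 * n * δ + 6 * n) ^ 2 + if i = j then 4 * (n : ℝ) ^ 4 else 0) :=
        Finset.sum_le_sum fun i _ => Finset.sum_le_sum fun j _ => h i j
    _ = n ^ 2 * (16 * n * δ + 6 * n) ^ 2 + 4 * n ^ 5 := by
        simp [Finset.sum_add_distrib]
        ring

theorem devM_switch {n : ℕ} {G : SimpleGraph (Fin n)} {ρ : ℝ} {x y z w : Fin n}
    (h : Switchable G x y z w) : devM (switch G x y z w) ρ = devM G ρ + switchMat x y z w := by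
  rw [devM, devM, adjM_switch h]
  abel

open Matrix in
theorem sum_switchable_frobSq_sub_le {n : ℕ} (G : SimpleGraph (Fin n)) {ρ δ : ℝ} (h0 : 0 ≤ ρ)
    (h1 : ρ ≤ 1) (hsum : ∑ k, (deg G k : ℝ) = n * (ρ * n))
    (hδ : ∀ u, |(deg G u : ℝ) - ρ * n| ≤ δ) :
    ∑ x, ∑ y, ∑ z, ∑ w, (if Switchable G x y z w then
      frobSq (devM (switch G x y z w) ρ * devM (switch G x y z w) ρ) -
        frobSq (devM G ρ * devM G ρ) else 0) ≤
      4 * (n ^ 2 * (16 * n * δ + 6 * n) ^ 2 + 4 * n ^ 5) + 576 * n ^ 5 -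
        16 * (n ^ 2 * ρ * (1 - ρ)) * frobSq (devM G ρ * devM G ρ) := by
  set B := devM G ρ with hBdef
  have hBt : Bᵀ = B := devM_transpose G ρ
  have hXt : (B * B * B)ᵀ = B * B * B := by simp only [transpose_mul, hBt, Matrix.mul_assoc]
  have hXB : frobInner (B * B * B) B = frobSq (B * B) := by
    rw [frobSq_eq_frobInner]
    simp only [frobInner_eq_trace, transpose_mul, hBt, Matrix.mul_assoc]
  have step : ∀ x y z w, (if Switchable G x y z w then
      frobSq (devM (switch G x y z w) ρ * devM (switch G x y z w) ρ) - frobSq (B * B) else 0) ≤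
      4 * ((if Switchable G x y z w then (1 : ℝ) else 0) *
        frobInner (B * B * B) (switchMat x y z w)) + 576 * n := by
    intro x y z w
    split_ifs with h
    · rw [devM_switch h, one_mul]
      exact frobSq_switch_le hBt (abs_devM_le G h0 h1) x y z w
    · rw [zero_mul]; positivity
  have hErr := frobSq_driftErr_le G h0 h1 hsum hδ
  have hdec : frobInner (B * B * B) (of fun u v =>
      coadjM G u v * (adjM G * coadjM G * adjM G) u v -
        adjM G u v * (coadjM G * adjM G * coadjM G) u v) =
      frobInner (B * B * B) (driftErr G ρ) - frobSq (B * B * B) -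
        n ^ 2 * ρ * (1 - ρ) * frobSq (B * B) := by
    rw [driftErr, ← hBdef, frobInner_add_right, frobInner_add_right, frobInner_smul_right, hXB,
      ← frobSq_eq_frobInner]
    ring
  have hle := frobInner_le (B * B * B) (driftErr G ρ)
  calc _ ≤ ∑ x : Fin n, ∑ y : Fin n, ∑ z : Fin n, ∑ w : Fin n,
        (4 * ((if Switchable G x y z w then (1 : ℝ) else 0) *
          frobInner (B * B * B) (switchMat x y z w)) + 576 * n) :=
        Finset.sum_le_sum fun x _ => Finset.sum_le_sum fun y _ => Finset.sum_le_sum fun z _ =>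
          Finset.sum_le_sum fun w _ => step x y z w
    _ = 4 * (4 * frobInner (B * B * B) (of fun u v =>
          coadjM G u v * (adjM G * coadjM G * adjM G) u v -
            adjM G u v * (coadjM G * adjM G * coadjM G) u v)) + 576 * n ^ 5 := by
        rw [← sum_switchable_frobInner G hXt]
        simp only [Finset.sum_add_distrib, ← Finset.mul_sum]
        simp
        ring
    _ ≤ _ := by
        rw [hdec]
        linarith

theorem sum_frobSq_devM_le {n : ℕ} (hn : 0 < n) (d : Fin n → ℕ) {ρ δ : ℝ} (h0 : 0 ≤ ρ)
    (h1 : ρ ≤ 1) (hsum : ∑ k, (d k : ℝ) = n * (ρ * n)) (hδ : ∀ u, |(d u : ℝ) - ρ * n| ≤ δ) :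
    ρ * (1 - ρ) * ∑ G ∈ degFinset n d, frobSq (devM G ρ * devM G ρ) ≤
      (degFinset n d).card * ((16 * n * δ + 6 * n) ^ 2 / 4 + 37 * n ^ 3) := by
  have h := sum_switch d fun G => frobSq (devM G ρ * devM G ρ)
  have hle : ∀ G ∈ degFinset n d, _ := fun G hG => by
    have hG' : ∀ j, deg G j = d j := by simpa [degFinset] using hG
    exact sum_switchable_frobSq_sub_le G h0 h1 (by simpa [hG'] using hsum)
      (by simpa [hG'] using hδ)
  have h2 := Finset.sum_le_sum hle
  rw [h] at h2
  simp only [Finset.sum_sub_distrib, Finset.sum_const, nsmul_eq_mul, ← Finset.mul_sum] at h2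
  have hn2 : (0 : ℝ) < 16 * n ^ 2 := by positivity
  refine le_of_mul_le_mul_left ?_ hn2
  linarith

open Matrix in
theorem frobSq_mul_self_add_le {n : ℕ} {X Y : Matrix (Fin n) (Fin n) ℝ} (hX : Xᵀ = X)
    (hY : Yᵀ = Y) :
    frobSq ((X + Y) * (X + Y)) ≤ 8 * (frobSq (X * X) + frobSq (Y * Y)) := by
  have h0 : frobInner ((X + Y) * (X + Y)) ((X - Y) * (X - Y)) =
      frobSq ((X + Y) * (X - Y)) := by
    have ha : (X + Y)ᵀ = X + Y := by rw [transpose_add, hX, hY]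
    have hb : (X - Y)ᵀ = X - Y := by rw [transpose_sub, hX, hY]
    rw [frobSq_eq_frobInner]
    simp only [frobInner_eq_trace, transpose_mul, ha, hb, Matrix.mul_assoc]
    rw [trace_mul_comm (X - Y)]
    simp only [Matrix.mul_assoc]
  have h1 : 2 • (X * X) + 2 • (Y * Y) = (X + Y) * (X + Y) + (X - Y) * (X - Y) := by
    noncomm_ring
  have h2 := frobSq_add ((X + Y) * (X + Y)) ((X - Y) * (X - Y))
  have h3 := frobSq_add_le (2 • (X * X)) (2 • (Y * Y))
  have h4 : ∀ M : Matrix (Fin n) (Fin n) ℝ, frobSq (2 • M) = 4 * frobSq M := by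
    intro M
    simp only [frobSq, Finset.mul_sum, Matrix.smul_apply, nsmul_eq_mul]
    exact Finset.sum_congr rfl fun i _ => Finset.sum_congr rfl fun j _ => by push_cast; ring
  rw [h4, h4, h1, h2, h0] at h3
  have := frobSq_nonneg ((X + Y) * (X - Y))
  have := frobSq_nonneg ((X - Y) * (X - Y))
  linarith

theorem frobSq_smul {n : ℕ} (c : ℝ) (M : Matrix (Fin n) (Fin n) ℝ) :
    frobSq (c • M) = c ^ 2 * frobSq M := by
  simp only [frobSq, Finset.mul_sum, Matrix.smul_apply, smul_eq_mul, mul_pow]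

/-- The symmetric matrix `N` with `ρ n (1 - N)` equal to the Laplacian plus the constant
matrix `ρ`. -/
noncomputable def normM {n : ℕ} (G : SimpleGraph (Fin n)) (ρ : ℝ) : Matrix (Fin n) (Fin n) ℝ :=
  (ρ * n)⁻¹ • (devM G ρ + Matrix.diagonal fun i => ρ * n - deg G i)

theorem normM_isHermitian {n : ℕ} (G : SimpleGraph (Fin n)) (ρ : ℝ) :
    (normM G ρ).IsHermitian := by
  rw [Matrix.IsHermitian, normM]
  simp [Matrix.conjTranspose_eq_transpose_of_trivial, devM_transpose]

theorem trace_normM {n : ℕ} (hn : 0 < n) (G : SimpleGraph (Fin n)) {ρ : ℝ} (h0 : 0 < ρ)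
    (hsum : ∑ k, (deg G k : ℝ) = n * (ρ * n)) : (normM G ρ).trace = -1 := by
  have hn' : (0 : ℝ) < n := by exact_mod_cast hn
  have e : ∀ i, adjM G i i = 0 := fun i => by simp [adjM]
  have t : (devM G ρ).trace = -(ρ * n) := by
    simp [Matrix.trace, devM_apply, e]
    ring
  rw [normM, Matrix.trace_smul, Matrix.trace_add, Matrix.trace_diagonal, t,
    Finset.sum_sub_distrib, hsum]
  simp
  field_simp

theorem frobSq_normM {n : ℕ} (hn : 0 < n) (G : SimpleGraph (Fin n)) {ρ : ℝ} (h0 : 0 < ρ)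
    (hsum : ∑ k, (deg G k : ℝ) = n * (ρ * n)) :
    frobSq (normM G ρ) =
      1 / ρ - 1 + (∑ i, ((deg G i : ℝ) - ρ * n) ^ 2) / (ρ * n) ^ 2 := by
  have hn' : (0 : ℝ) < n := by exact_mod_cast hn
  have hA2 : ∀ i j, adjM G i j ^ 2 = adjM G i j := fun i j => by
    unfold adjM; split_ifs <;> norm_num
  have e1 : frobSq (devM G ρ) = n * (ρ * n) - (ρ * n) ^ 2 := by
    have : ∀ i j, devM G ρ i j ^ 2 = (1 - 2 * ρ) * adjM G i j + ρ ^ 2 := fun i j => by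
      rw [devM_apply, sub_sq, hA2]; ring
    simp only [frobSq, this, Finset.sum_add_distrib, ← Finset.mul_sum, sum_adjM, hsum]
    simp
    ring
  have e2 : frobInner (devM G ρ) (Matrix.diagonal fun i => ρ * n - (deg G i : ℝ)) = 0 := by
    have hd : ∀ i, devM G ρ i i = -ρ := fun i => by rw [devM_apply]; simp [adjM]
    simp only [frobInner, Matrix.diagonal_apply, mul_ite, mul_zero, Finset.sum_ite_eq,
      Finset.mem_univ, if_true, hd, ← Finset.mul_sum, Finset.sum_sub_distrib, hsum]
    simp
    right
    ring
  have e3 : frobSq (Matrix.diagonal fun i => ρ * n - (deg G i : ℝ)) =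
      ∑ i, ((deg G i : ℝ) - ρ * n) ^ 2 := by
    simp only [frobSq, Matrix.diagonal_apply, ite_pow, Finset.sum_ite_eq, Finset.mem_univ,
      if_true, ne_eq, OfNat.ofNat_ne_zero, not_false_eq_true, zero_pow]
    exact Finset.sum_congr rfl fun i _ => by ring
  rw [normM, frobSq_smul, frobSq_add, e1, e2, e3]
  field_simp
  ring

theorem frobSq_normM_sq_le {n : ℕ} (hn : 0 < n) (G : SimpleGraph (Fin n)) {ρ δ : ℝ} (h0 : 0 < ρ)
    (hδ : ∀ u, |(deg G u : ℝ) - ρ * n| ≤ δ) :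
    frobSq (normM G ρ * normM G ρ) ≤
      8 / (ρ * n) ^ 4 * (frobSq (devM G ρ * devM G ρ) + n * δ ^ 4) := by
  have h1 : frobSq ((Matrix.diagonal fun i => ρ * n - (deg G i : ℝ)) *
      (Matrix.diagonal fun i => ρ * n - (deg G i : ℝ))) ≤ n * δ ^ 4 := by
    rw [Matrix.diagonal_mul_diagonal]
    simp only [frobSq, Matrix.diagonal_apply, ite_pow, Finset.sum_ite_eq, Finset.mem_univ,
      if_true, ne_eq, OfNat.ofNat_ne_zero, not_false_eq_true, zero_pow]
    calc _ ≤ ∑ _i : Fin n, δ ^ 4 := Finset.sum_le_sum fun i _ => by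
          have := pow_le_pow_left₀ (abs_nonneg _) (hδ i) 4
          rw [pow_abs, abs_of_nonneg (by positivity)] at this
          linarith [this]
      _ = n * δ ^ 4 := by simp
  have h2 := frobSq_mul_self_add_le (devM_transpose G ρ)
    (Matrix.diagonal_transpose fun i => ρ * n - (deg G i : ℝ))
  rw [normM, smul_mul_assoc, mul_smul_comm, smul_smul, frobSq_smul]
  calc _ ≤ ((ρ * n)⁻¹ * (ρ * n)⁻¹) ^ 2 * (8 * (frobSq (devM G ρ * devM G ρ) + n * δ ^ 4)) := by
        refine mul_le_mul_of_nonneg_left ?_ (sq_nonneg _)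
        linarith
    _ = _ := by
        field_simp

theorem pow_mul_det_one_sub_normM {n : ℕ} (hn : 0 < n) (G : SimpleGraph (Fin n)) {ρ : ℝ}
    (h0 : 0 < ρ) : (ρ * n) ^ n * (1 - normM G ρ).det = ρ * n ^ 2 * treeCount G := by
  have hn' : (0 : ℝ) < n := by exact_mod_cast hn
  rw [← det_laplacian_add_const hn G h0.le]
  have e : Matrix.diagonal (fun i => (deg G i : ℝ)) - adjM G + ρ • (Matrix.of fun _ _ => 1) =
      (ρ * n) • (1 - normM G ρ) := by
    rw [normM, smul_sub, smul_smul, mul_inv_cancel₀ (by positivity), one_smul, devM]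
    have : (ρ * n : ℝ) • (1 : Matrix (Fin n) (Fin n) ℝ) =
        Matrix.diagonal (fun i => (deg G i : ℝ)) + Matrix.diagonal fun i => ρ * n - deg G i := by
      rw [Matrix.diagonal_add]
      simp [Matrix.smul_one_eq_diagonal]
    rw [this]
    abel
  rw [e, Matrix.det_smul, Fintype.card_fin]

/-- The main term for the number of spanning trees, in terms of `ρ = d̄ / n` and
`S = ∑ (d_j - d̄)²`. -/
noncomputable def mainTerm (n : ℕ) (ρ S : ℝ) : ℝ :=
  (ρ * n) ^ n / (ρ * n ^ 2) * Real.exp (1 - (1 / ρ - 1 + S / (ρ * n) ^ 2) / 2)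

theorem mainTerm_pos {n : ℕ} (hn : 0 < n) {ρ : ℝ} (h0 : 0 < ρ) (S : ℝ) : 0 < mainTerm n ρ S := by
  have hn' : (0 : ℝ) < n := by exact_mod_cast hn
  unfold mainTerm
  positivity

theorem treeCount_eq_mainTerm_mul_exp {n : ℕ} (hn : 0 < n) (G : SimpleGraph (Fin n)) {ρ : ℝ}
    (h0 : 0 < ρ) (hsum : ∑ k, (deg G k : ℝ) = n * (ρ * n))
    (h4 : 16 * frobSq (normM G ρ * normM G ρ) ≤ 1) :
    ∃ θ : ℝ, |θ| ≤ 2 * Real.sqrt ((1 / ρ - 1 + (∑ i, ((deg G i : ℝ) - ρ * n) ^ 2) / (ρ * n) ^ 2) *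
        frobSq (normM G ρ * normM G ρ)) ∧
      (treeCount G : ℝ) =
        mainTerm n ρ (∑ i, ((deg G i : ℝ) - ρ * n) ^ 2) * Real.exp θ := by
  have hn' : (0 : ℝ) < n := by exact_mod_cast hn
  obtain ⟨θ, hθ, h⟩ := det_one_sub_eq_exp (normM_isHermitian G ρ) h4
  rw [frobSq_normM hn G h0 hsum] at hθ h
  rw [trace_normM hn G h0 hsum] at h
  refine ⟨θ, hθ, ?_⟩
  have h2 := pow_mul_det_one_sub_normM hn G h0
  rw [h] at h2
  rw [mainTerm, mul_assoc, ← Real.exp_add, div_mul_eq_mul_div, eq_div_iff (by positivity),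
    mul_comm (treeCount G : ℝ), ← h2]
  congr 2
  ring

theorem treeCount_le_mainTerm_mul_exp {n : ℕ} (hn : 0 < n) (G : SimpleGraph (Fin n)) {ρ δ : ℝ}
    (h0 : 0 < ρ) (hsum : ∑ k, (deg G k : ℝ) = n * (ρ * n))
    (hδ : ∀ u, |(deg G u : ℝ) - ρ * n| ≤ δ) (hδ1 : δ ≤ ρ * n / 2)
    (hδ3 : 2 * n * δ ^ 3 ≤ (ρ * n) ^ 3) :
    (treeCount G : ℝ) ≤ mainTerm n ρ (∑ i, ((deg G i : ℝ) - ρ * n) ^ 2) *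
      Real.exp (2 + 1 / (2 * ρ)) := by
  have hn' : (0 : ℝ) < n := by exact_mod_cast hn
  have hD : 0 < ρ * n := by positivity
  set S := ∑ i, ((deg G i : ℝ) - ρ * n) ^ 2 with hS
  have hdeg : ∀ i, ρ * n / 2 ≤ deg G i := fun i => by
    have := (abs_le.1 (hδ i)).1
    linarith
  have hdegp : ∀ i, (0 : ℝ) < deg G i := fun i => lt_of_lt_of_le (by positivity) (hdeg i)
  have h1 := det_le_prod_mul_exp (posSemidef_laplacian_add_const G h0.le)
    (fun i => (deg G i : ℝ)) hdegp
  rw [det_laplacian_add_const hn G h0.le] at h1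
  have h2 : ∑ i, (Matrix.diagonal (fun i => (deg G i : ℝ)) - adjM G +
      ρ • (Matrix.of fun _ _ => 1) : Matrix (Fin n) (Fin n) ℝ) i i / (deg G i : ℝ) - n ≤ 2 := by
    have e : ∀ i, (Matrix.diagonal (fun i => (deg G i : ℝ)) - adjM G +
        ρ • (Matrix.of fun _ _ => 1) : Matrix (Fin n) (Fin n) ℝ) i i / (deg G i : ℝ) ≤ 1 + 2 / n := by
      intro i
      have : adjM G i i = 0 := by simp [adjM]
      simp only [Matrix.add_apply, Matrix.sub_apply, Matrix.diagonal_apply_eq, this,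
        Matrix.smul_apply, Matrix.of_apply, smul_eq_mul, mul_one, sub_zero]
      rw [div_le_iff₀ (hdegp i)]
      have h3 := hdeg i
      have h4 : 2 / (n : ℝ) * (ρ * n / 2) ≤ 2 / n * deg G i :=
        mul_le_mul_of_nonneg_left h3 (by positivity)
      have h5 : 2 / (n : ℝ) * (ρ * n / 2) = ρ := by field_simp
      linarith
    have := Finset.sum_le_sum fun i (_ : i ∈ Finset.univ) => e i
    have h6 : ∑ _i : Fin n, (1 + 2 / (n : ℝ)) = n + 2 := by
      simp
      field_simp
    linarith
  have h3 : ∏ i, (deg G i : ℝ) ≤ (ρ * n) ^ n * Real.exp (1 - S / (ρ * n) ^ 2 / 2) := by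
    have hi : ∀ i, (deg G i : ℝ) ≤ (ρ * n) * Real.exp (((deg G i : ℝ) - ρ * n) / (ρ * n) -
        ((deg G i : ℝ) - ρ * n) ^ 2 / (ρ * n) ^ 2 / 2 + 1 / n) := by
      intro i
      set x := -(((deg G i : ℝ) - ρ * n) / (ρ * n)) with hx
      have hxabs : |x| ≤ δ / (ρ * n) := by
        rw [hx, abs_neg, abs_div, abs_of_pos hD]
        exact div_le_div_of_nonneg_right (hδ i) hD.le
      have hx2 : |x| ≤ 1 / 2 := hxabs.trans (by rw [div_le_iff₀ hD]; linarith)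
      have hlog := (abs_le.1 (abs_log_one_sub_le hx2)).2
      have e1 : (deg G i : ℝ) = (ρ * n) * (1 - x) := by
        rw [hx]; field_simp; ring
      have hpos : 0 < 1 - x := by linarith [(abs_le.1 hx2).2]
      have hx3 : 2 * |x| ^ 3 ≤ 1 / n := by
        have := pow_le_pow_left₀ (abs_nonneg _) hxabs 3
        have h7 : 2 * (δ / (ρ * n)) ^ 3 ≤ 1 / n := by
          rw [div_pow, ← mul_div_assoc, div_le_div_iff₀ (by positivity) hn']
          linarith
        linarith
      calc (deg G i : ℝ) = (ρ * n) * Real.exp (Real.log (1 - x)) := by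
            rw [Real.exp_log hpos, ← e1]
        _ ≤ _ := by
            refine mul_le_mul_of_nonneg_left (Real.exp_le_exp.2 ?_) hD.le
            have e2 : ((deg G i : ℝ) - ρ * n) / (ρ * n) = -x := by rw [hx]; ring
            have e3 : ((deg G i : ℝ) - ρ * n) ^ 2 / (ρ * n) ^ 2 = x ^ 2 := by
              rw [hx, neg_sq, div_pow]
            rw [e2, e3]
            linarith
    refine (Finset.prod_le_prod (fun i _ => (hdegp i).le) fun i _ => hi i).trans_eq ?_
    rw [Finset.prod_mul_distrib, ← Real.exp_sum]
    simp only [Finset.prod_const, Finset.card_univ, Fintype.card_fin, Finset.sum_add_distrib,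
      Finset.sum_sub_distrib, ← Finset.sum_div, hsum, ← hS, Finset.sum_const, nsmul_eq_mul]
    congr 2
    field_simp
    ring
  have h4 : ρ * n ^ 2 * treeCount G ≤
      (ρ * n) ^ n * Real.exp (1 - S / (ρ * n) ^ 2 / 2) * Real.exp 2 :=
    h1.trans (mul_le_mul h3 (Real.exp_le_exp.2 h2) (Real.exp_pos _).le (by positivity))
  rw [mainTerm, div_mul_eq_mul_div, div_mul_eq_mul_div, le_div_iff₀ (by positivity),
    mul_comm (treeCount G : ℝ)]
  refine h4.trans ?_
  rw [mul_assoc, mul_assoc, ← Real.exp_add, ← Real.exp_add]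
  refine mul_le_mul_of_nonneg_left (Real.exp_le_exp.2 ?_) (by positivity)
  have : 1 / (2 * ρ) = 1 / ρ / 2 := by field_simp
  rw [this]
  linarith

theorem abs_treeCount_sub_mainTerm_le {n : ℕ} (hn : 0 < n) (G : SimpleGraph (Fin n)) {ρ δ θ₀ : ℝ}
    (h0 : 0 < ρ) (h1 : ρ ≤ 1) (hsum : ∑ k, (deg G k : ℝ) = n * (ρ * n))
    (hδ : ∀ u, |(deg G u : ℝ) - ρ * n| ≤ δ) (hδ1 : δ ≤ ρ * n / 2)
    (hδ3 : 2 * n * δ ^ 3 ≤ (ρ * n) ^ 3) (hθ₀ : 0 < θ₀) {σ S : ℝ}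
    (hS : S = ∑ i, ((deg G i : ℝ) - ρ * n) ^ 2) (hσ : σ = 1 / ρ - 1 + S / (ρ * n) ^ 2) :
    |(treeCount G : ℝ) - mainTerm n ρ S| ≤ mainTerm n ρ S * (2 * θ₀ +
      frobSq (normM G ρ * normM G ρ) *
        (2 * σ / θ₀ + (16 + 4 * σ) * Real.exp (2 + 1 / (2 * ρ)))) := by
  have hM := mainTerm_pos hn h0 S
  set M := mainTerm n ρ S with hMdef
  set s4 := frobSq (normM G ρ * normM G ρ) with hs4
  have hs40 : 0 ≤ s4 := frobSq_nonneg _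
  have hσ0 : 0 ≤ σ := by
    have : 1 ≤ 1 / ρ := by rw [le_div_iff₀ h0]; linarith
    have : 0 ≤ S / (ρ * n) ^ 2 := by
      rw [hS]
      exact div_nonneg (Finset.sum_nonneg fun _ _ => sq_nonneg _) (sq_nonneg _)
    linarith
  set K := Real.exp (2 + 1 / (2 * ρ)) with hK
  have hK1 : 1 ≤ K := by
    rw [hK]
    exact Real.one_le_exp (by positivity)
  have hbad : |(treeCount G : ℝ) - M| ≤ M * K := by
    have hle := treeCount_le_mainTerm_mul_exp hn G h0 hsum hδ hδ1 hδ3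
    rw [← hS, ← hMdef, ← hK] at hle
    have : (0 : ℝ) ≤ treeCount G := Nat.cast_nonneg _
    have := le_mul_of_one_le_right hM.le hK1
    rw [abs_le]
    constructor <;> linarith
  have hp1 : 0 ≤ 2 * σ / θ₀ := by positivity
  have hp2 : 0 ≤ σ * s4 := by positivity
  have hp3 : 0 ≤ s4 * (2 * σ / θ₀) := by positivity
  have hp4 : 0 ≤ σ * s4 * K := by positivity
  have hp5 : 0 ≤ s4 * K := by positivity
  by_cases hA : 16 * s4 ≤ 1
  · by_cases hB : 4 * (σ * s4) ≤ 1
    · obtain ⟨θ, hθ, h⟩ := treeCount_eq_mainTerm_mul_exp hn G h0 hsum hA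
      rw [← hS, ← hσ, ← hs4] at hθ
      rw [← hS, ← hMdef] at h
      have hsq : Real.sqrt (σ * s4) ≤ 1 / 2 := by
        rw [Real.sqrt_le_left (by norm_num)]
        linarith
      have hθ1 : |θ| ≤ 1 := by linarith
      have hexp := Real.abs_exp_sub_one_le hθ1
      have ham : 2 * Real.sqrt (σ * s4) ≤ θ₀ + s4 * σ / θ₀ := by
        have hs := Real.sq_sqrt hp2
        have hz := sq_nonneg (Real.sqrt (σ * s4) - θ₀)
        have : θ₀ + s4 * σ / θ₀ = (θ₀ ^ 2 + s4 * σ) / θ₀ := by field_simp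
        rw [this, le_div_iff₀ hθ₀]
        linarith
      rw [h, show M * Real.exp θ - M = M * (Real.exp θ - 1) by ring, abs_mul, abs_of_pos hM]
      refine mul_le_mul_of_nonneg_left ?_ hM.le
      have : s4 * (2 * σ / θ₀) = 2 * (s4 * σ / θ₀) := by ring
      linarith
    · refine hbad.trans (mul_le_mul_of_nonneg_left ?_ hM.le)
      have : K ≤ 4 * (σ * s4) * K := le_mul_of_one_le_left (by linarith) (by linarith)
      linarith
  · refine hbad.trans (mul_le_mul_of_nonneg_left ?_ hM.le)
    have : K ≤ 16 * s4 * K := le_mul_of_one_le_left (by linarith) (by linarith)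
    linarith

theorem abs_expTrees_sub_mainTerm_le {n : ℕ} (hn : 0 < n) {d : Fin n → ℕ}
    (hne : (degFinset n d).Nonempty) {ρ δ θ₀ : ℝ}
    (h0 : 0 < ρ) (h1 : ρ < 1) (hsum : ∑ k, (d k : ℝ) = n * (ρ * n))
    (hδ : ∀ u, |(d u : ℝ) - ρ * n| ≤ δ) (hδ1 : δ ≤ ρ * n / 2)
    (hδ3 : 2 * n * δ ^ 3 ≤ (ρ * n) ^ 3) (hθ₀ : 0 < θ₀) {σ S : ℝ}
    (hS : S = ∑ i, ((d i : ℝ) - ρ * n) ^ 2) (hσ : σ = 1 / ρ - 1 + S / (ρ * n) ^ 2) :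
    |expTrees n d - mainTerm n ρ S| ≤ mainTerm n ρ S * (2 * θ₀ +
      8 / (ρ * n) ^ 4 * (((16 * n * δ + 6 * n) ^ 2 / 4 + 37 * n ^ 3) / (ρ * (1 - ρ)) + n * δ ^ 4) *
        (2 * σ / θ₀ + (16 + 4 * σ) * Real.exp (2 + 1 / (2 * ρ)))) := by
  have hM := mainTerm_pos hn h0 S
  set M := mainTerm n ρ S with hMdef
  set L := 2 * σ / θ₀ + (16 + 4 * σ) * Real.exp (2 + 1 / (2 * ρ)) with hL
  have hσ0 : 0 ≤ σ := by
    have : 1 ≤ 1 / ρ := by rw [le_div_iff₀ h0]; linarith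
    have : 0 ≤ S / (ρ * n) ^ 2 := by
      rw [hS]
      exact div_nonneg (Finset.sum_nonneg fun _ _ => sq_nonneg _) (sq_nonneg _)
    linarith
  have hL0 : 0 ≤ L := by positivity
  set g := (degFinset n d).card with hg
  have hg0 : (0 : ℝ) < g := by exact_mod_cast hne.card_pos
  set V := ((16 * n * δ + 6 * n) ^ 2 / 4 + 37 * n ^ 3) / (ρ * (1 - ρ)) with hV
  have hρ : 0 < ρ * (1 - ρ) := mul_pos h0 (by linarith)
  have hf : ∑ G ∈ degFinset n d, frobSq (devM G ρ * devM G ρ) ≤ g * V := by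
    have := sum_frobSq_devM_le hn d h0.le h1.le hsum hδ
    rw [hV, ← mul_div_assoc, le_div_iff₀ hρ]
    linarith
  have hG : ∀ G ∈ degFinset n d, |(treeCount G : ℝ) - M| ≤ M * (2 * θ₀ +
      8 / (ρ * n) ^ 4 * (frobSq (devM G ρ * devM G ρ) + n * δ ^ 4) * L) := by
    intro G hG
    have hG' : ∀ j, deg G j = d j := by simpa [degFinset] using hG
    have hs : ∑ k, (deg G k : ℝ) = n * (ρ * n) := by simpa [hG'] using hsum
    have hd : ∀ u, |(deg G u : ℝ) - ρ * n| ≤ δ := by simpa [hG'] using hδ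
    refine (abs_treeCount_sub_mainTerm_le hn G h0 h1.le hs hd hδ1 hδ3 hθ₀
      (by simpa [hG'] using hS) hσ).trans ?_
    refine mul_le_mul_of_nonneg_left ?_ hM.le
    have := mul_le_mul_of_nonneg_right (frobSq_normM_sq_le hn G h0 hd) hL0
    linarith
  have e : expTrees n d - M = (∑ G ∈ degFinset n d, ((treeCount G : ℝ) - M)) / g := by
    rw [Finset.sum_sub_distrib, Finset.sum_const, nsmul_eq_mul, expTrees, ← hg]
    field_simp
  rw [e, abs_div, abs_of_pos hg0, div_le_iff₀ hg0]
  refine ((Finset.abs_sum_le_sum_abs _ _).trans (Finset.sum_le_sum hG)).trans ?_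
  have hc : 0 ≤ 8 / (ρ * n) ^ 4 * L := by positivity
  have h3 := mul_le_mul_of_nonneg_left hf hc
  rw [← Finset.mul_sum, mul_assoc]
  refine mul_le_mul_of_nonneg_left ?_ hM.le
  simp only [Finset.sum_add_distrib, ← Finset.sum_mul, ← Finset.mul_sum, Finset.sum_const,
    nsmul_eq_mul, ← hg]
  linarith

theorem abs_expTrees_sub_mainTerm_le_of_bounds {n : ℕ} (hn : 0 < n) {d : Fin n → ℕ}
    (hne : (degFinset n d).Nonempty) {ρ δ θ₀ S x y : ℝ} (h0 : 0 < ρ) (h1 : ρ < 1)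
    (hsum : ∑ k, (d k : ℝ) = n * (ρ * n)) (hδ : ∀ u, |(d u : ℝ) - ρ * n| ≤ δ) (hθ₀ : 0 < θ₀)
    (hS : S = ∑ i, ((d i : ℝ) - ρ * n) ^ 2) (hx : 2 ≤ x) (hy : y ^ 2 = n) (hxy : x ^ 10 ≤ y)
    (hρx : 1 ≤ ρ * x) (hρx' : 1 ≤ (1 - ρ) * x) (hδx : δ ≤ y * x ^ 2) :
    |expTrees n d - mainTerm n ρ S| ≤ mainTerm n ρ S * (2 * θ₀ +
      1272 * x ^ 12 / n * (4 * x ^ 6 / θ₀ + 24 * x ^ 6 * Real.exp (2 + 1 / (2 * ρ)))) := by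
  have hn' : (0 : ℝ) < n := by exact_mod_cast hn
  have hx1 : 1 ≤ x := by linarith
  have hy0 : 0 < y := lt_of_lt_of_le (by positivity) hxy
  have hδ0 : 0 ≤ δ := (abs_nonneg _).trans (hδ ⟨0, hn⟩)
  have hD : 0 < ρ * n := by positivity
  have hDx : n ≤ ρ * n * x := by nlinarith
  have h9 : 2 * x ^ 9 ≤ y := by
    have : x ^ 10 = x * x ^ 9 := by ring
    have := mul_le_mul_of_nonneg_right hx (by positivity : 0 ≤ x ^ 9)
    linarith
  have h3 : 2 * x ^ 3 ≤ y := by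
    have : x ^ 3 ≤ x ^ 9 := pow_le_pow_right₀ hx1 (by norm_num)
    linarith
  have hδ1 : δ ≤ ρ * n / 2 := by
    have ha : δ * (2 * x) ≤ n := by
      calc δ * (2 * x) ≤ y * x ^ 2 * (2 * x) := mul_le_mul_of_nonneg_right hδx (by positivity)
        _ = y * (2 * x ^ 3) := by ring
        _ ≤ y * y := mul_le_mul_of_nonneg_left h3 hy0.le
        _ = n := by rw [← hy]; ring
    have hb : δ * 2 * x ≤ ρ * n * x := by linarith
    have := le_of_mul_le_mul_right hb (by linarith)
    linarith
  have hδ3 : 2 * n * δ ^ 3 ≤ (ρ * n) ^ 3 := by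
    have hb : 2 * n * δ ^ 3 * x ^ 3 ≤ (ρ * n) ^ 3 * x ^ 3 := by
      calc 2 * n * δ ^ 3 * x ^ 3 ≤ 2 * n * (y * x ^ 2) ^ 3 * x ^ 3 := by gcongr
        _ = n * y ^ 3 * (2 * x ^ 9) := by ring
        _ ≤ n * y ^ 3 * y := by gcongr
        _ = (n : ℝ) ^ 3 := by rw [← hy]; ring
        _ ≤ (ρ * n * x) ^ 3 := by gcongr
        _ = _ := by ring
    exact le_of_mul_le_mul_right hb (by positivity)
  have hS0 : 0 ≤ S := by rw [hS]; exact Finset.sum_nonneg fun _ _ => sq_nonneg _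
  have hS1 : S ≤ n ^ 2 * x ^ 4 := by
    calc S ≤ ∑ _i : Fin n, (y * x ^ 2) ^ 2 := by
          rw [hS]
          refine Finset.sum_le_sum fun i _ => ?_
          rw [← sq_abs]
          exact pow_le_pow_left₀ (abs_nonneg _) ((hδ i).trans hδx) 2
      _ = n ^ 2 * x ^ 4 := by simp; rw [← hy]; ring
  have hinv : 1 / ρ ≤ x := by rw [div_le_iff₀ h0]; linarith
  have hSD : S / (ρ * n) ^ 2 ≤ x ^ 6 := by
    rw [div_le_iff₀ (by positivity)]
    calc S ≤ n ^ 2 * x ^ 4 := hS1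
      _ ≤ (ρ * n * x) ^ 2 * x ^ 4 := by gcongr
      _ = _ := by ring
  obtain ⟨σ, hσ⟩ : ∃ σ, σ = 1 / ρ - 1 + S / (ρ * n) ^ 2 := ⟨_, rfl⟩
  have hσ1 : σ ≤ 2 * x ^ 6 := by
    have : x ≤ x ^ 6 := le_self_pow₀ hx1 (by norm_num)
    linarith
  have hσ0 : 0 ≤ σ := by
    have : 1 ≤ 1 / ρ := by rw [le_div_iff₀ h0]; linarith
    have : 0 ≤ S / (ρ * n) ^ 2 := by positivity
    linarith
  refine (abs_expTrees_sub_mainTerm_le hn hne h0 h1 hsum hδ hδ1 hδ3 hθ₀ hS hσ).trans ?_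
  refine mul_le_mul_of_nonneg_left ?_ (mainTerm_pos hn h0 S).le
  refine add_le_add_right (mul_le_mul ?_ ?_ (by positivity) (by positivity)) _
  · have hρ : 0 < ρ * (1 - ρ) := mul_pos h0 (by linarith)
    have hK : (16 * n * δ + 6 * n) ^ 2 / 4 + 37 * n ^ 3 ≤ 158 * (n : ℝ) ^ 3 * x ^ 4 := by
      have hyx : 1 ≤ y * x ^ 2 := by
        have : 1 ≤ x ^ 10 := one_le_pow₀ hx1
        exact one_le_mul_of_one_le_of_one_le (by linarith) (one_le_pow₀ hx1)
      have e1 : 16 * n * δ + 6 * n ≤ 22 * n * (y * x ^ 2) := by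
        have := mul_le_mul_of_nonneg_left hδx hn'.le
        have := mul_le_mul_of_nonneg_left hyx hn'.le
        linarith
      have e2 : (16 * n * δ + 6 * n) ^ 2 ≤ (22 * n * (y * x ^ 2)) ^ 2 := by gcongr
      have e3 : (22 * n * (y * x ^ 2)) ^ 2 = 484 * (n : ℝ) ^ 3 * x ^ 4 := by
        calc _ = 484 * n ^ 2 * y ^ 2 * x ^ 4 := by ring
          _ = _ := by rw [hy]; ring
      have e4 : (n : ℝ) ^ 3 * 1 ≤ n ^ 3 * x ^ 4 := by
        have : 1 ≤ x ^ 4 := one_le_pow₀ hx1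
        gcongr
      linarith
    have hV : ((16 * n * δ + 6 * n) ^ 2 / 4 + 37 * n ^ 3) / (ρ * (1 - ρ)) ≤
        158 * (n : ℝ) ^ 3 * x ^ 6 := by
      rw [div_le_iff₀ hρ]
      have : 1 ≤ (ρ * x) * ((1 - ρ) * x) := one_le_mul_of_one_le_of_one_le hρx hρx'
      calc _ ≤ 158 * (n : ℝ) ^ 3 * x ^ 4 * 1 := by linarith
        _ ≤ 158 * (n : ℝ) ^ 3 * x ^ 4 * ((ρ * x) * ((1 - ρ) * x)) := by gcongr
        _ = _ := by ring
    have hd4 : n * δ ^ 4 ≤ (n : ℝ) ^ 3 * x ^ 8 := by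
      calc n * δ ^ 4 ≤ n * (y * x ^ 2) ^ 4 := by gcongr
        _ = n * (y ^ 2) ^ 2 * x ^ 8 := by ring
        _ = _ := by rw [hy]; ring
    have hx68 : (n : ℝ) ^ 3 * x ^ 6 ≤ n ^ 3 * x ^ 8 := by
      have : x ^ 6 ≤ x ^ 8 := pow_le_pow_right₀ hx1 (by norm_num)
      gcongr
    have h8 : 8 / (ρ * n) ^ 4 ≤ 8 * x ^ 4 / n ^ 4 := by
      rw [div_le_div_iff₀ (by positivity) (by positivity)]
      calc 8 * (n : ℝ) ^ 4 ≤ 8 * (ρ * n * x) ^ 4 := by gcongr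
        _ = _ := by ring
    calc _ ≤ 8 * x ^ 4 / n ^ 4 * (159 * (n : ℝ) ^ 3 * x ^ 8) := by
          refine mul_le_mul h8 (by linarith) ?_ (by positivity)
          have : 0 ≤ ((16 * n * δ + 6 * n) ^ 2 / 4 + 37 * n ^ 3) / (ρ * (1 - ρ)) := by positivity
          positivity
      _ = _ := by
          field_simp
          ring
  · have hx6 : 1 ≤ x ^ 6 := one_le_pow₀ hx1
    refine add_le_add ?_ (mul_le_mul_of_nonneg_right (by linarith) (Real.exp_pos _).le)
    exact div_le_div_of_nonneg_right (by linarith) hθ₀.le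

theorem mainTerm_eq {n : ℕ} (hn : 2 ≤ n) {D S : ℝ} (hD : 0 < D) (hS : 0 ≤ S) :
    ∃ φ : ℝ, |φ| ≤ 1 / n + 1 / D + S / n / D ^ 2 ∧
      mainTerm n (D / n) S = (n : ℝ) ^ (n - 2) * (D / (n - 1)) ^ (n - 1) *
        Real.exp (-((1 - D / (n - 1)) / (2 * (D / (n - 1)))) -
          S / n / (2 * (D / (n - 1)) ^ 2 * n) + φ) := by
  obtain ⟨m, rfl⟩ := Nat.exists_eq_add_of_le' hn
  have e1 : m + 2 - 2 = m := rfl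
  have e2 : m + 2 - 1 = m + 1 := rfl
  obtain ⟨k, hk⟩ : ∃ k : ℝ, k = ((m + 2 : ℕ) : ℝ) := ⟨_, rfl⟩
  have hk2 : (2 : ℝ) ≤ k := by rw [hk]; exact_mod_cast hn
  have hkp : 0 < k := by linarith
  have hk1 : 0 < k - 1 := by linarith
  have hkm : k - 1 = (m + 1 : ℕ) := by rw [hk]; push_cast; ring
  rw [e1, e2, mainTerm, ← hk]
  obtain ⟨l, hl⟩ : ∃ l, l = Real.log ((k - 1) / k) := ⟨_, rfl⟩
  have hpow : ((k - 1) / k) ^ (m + 1) = Real.exp ((k - 1) * l) := by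
    rw [hkm, Real.exp_nat_mul, hl, Real.exp_log (by positivity), ← hkm]
  have hl1 : l ≤ -(1 / k) := by
    have := Real.log_le_sub_one_of_pos (show 0 < (k - 1) / k by positivity)
    rw [← hl] at this
    have e : (k - 1) / k - 1 = -(1 / k) := by field_simp; ring
    linarith
  have hl2 : -(1 / (k - 1)) ≤ l := by
    have := Real.one_sub_inv_le_log_of_pos (show 0 < (k - 1) / k by positivity)
    rw [← hl] at this
    have e : 1 - ((k - 1) / k)⁻¹ = -(1 / (k - 1)) := by field_simp; ring
    linarith
  have hm1 : (k - 1) * l ≤ -1 + 1 / k := by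
    have := mul_le_mul_of_nonneg_left hl1 hk1.le
    have e : (k - 1) * -(1 / k) = -1 + 1 / k := by field_simp; ring
    linarith
  have hm2 : -1 ≤ (k - 1) * l := by
    have := mul_le_mul_of_nonneg_left hl2 hk1.le
    have e : (k - 1) * -(1 / (k - 1)) = -1 := by field_simp
    linarith
  have hD1 : 0 < 1 / D := by positivity
  have hR0 : 0 ≤ S / k / D ^ 2 := by positivity
  have hR1 : 0 ≤ S / k / D ^ 2 * (1 / (2 * k)) := by positivity
  have hR2 : S / k / D ^ 2 * (1 / (2 * k)) ≤ S / k / D ^ 2 * 1 := by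
    refine mul_le_mul_of_nonneg_left ?_ hR0
    rw [div_le_one (by positivity)]
    linarith
  refine ⟨((k - 1) * l + 1) - 1 / D / 2 - (S / k / D ^ 2 - S / k / D ^ 2 * (1 / (2 * k))), ?_, ?_⟩
  · rw [abs_le]
    constructor <;> linarith
  · have hpre : (D / k * k) ^ (m + 2) / (D / k * k ^ 2) =
        k ^ m * (D / (k - 1)) ^ (m + 1) * Real.exp ((k - 1) * l) := by
      rw [← hpow, div_pow, div_pow]
      field_simp
      ring
    rw [hpre, mul_assoc, mul_assoc, mul_assoc, ← Real.exp_add]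
    congr 3
    field_simp
    ring

theorem abs_log_le_of_abs_sub_one_le {t : ℝ} (ht : |t - 1| ≤ 1 / 2) :
    |Real.log t| ≤ 2 * |t - 1| := by
  have h := abs_le.1 ht
  have htp : 0 < t := by linarith
  have h1 := Real.log_le_sub_one_of_pos htp
  have h2 := Real.one_sub_inv_le_log_of_pos htp
  have h3 : -(2 * |t - 1|) ≤ 1 - t⁻¹ := by
    have e : 1 - t⁻¹ = (t - 1) / t := by field_simp
    rw [e, le_div_iff₀ htp]
    have h5 := neg_abs_le (t - 1)
    have h6 : |t - 1| * (1 / 2) ≤ |t - 1| * t :=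
      mul_le_mul_of_nonneg_left (by linarith) (abs_nonneg _)
    linarith
  rw [abs_le]
  have := le_abs_self (t - 1)
  have := abs_nonneg (t - 1)
  constructor <;> linarith

theorem eventually_bounds {κ b : ℝ} (hκ : 0 < κ) (hb : 0 < b) (a C₀ K : ℝ) :
    ∃ N : ℕ, ∀ n : ℕ, N ≤ n → 2 ≤ n ∧ 2 ≤ (n : ℝ) ^ κ ∧ C₀ ≤ (n : ℝ) ^ κ ∧
      3 * a * Real.log n ≤ (n : ℝ) ^ κ ∧ K * (n : ℝ) ^ (-b) ≤ 1 / 2 := by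
  have hc : Filter.Tendsto (fun n : ℕ => (n : ℝ)) Filter.atTop Filter.atTop :=
    tendsto_natCast_atTop_atTop
  have h1 : Filter.Tendsto (fun n : ℕ => (n : ℝ) ^ κ) Filter.atTop Filter.atTop :=
    (tendsto_rpow_atTop hκ).comp hc
  have h2 : Filter.Tendsto (fun n : ℕ => K * (n : ℝ) ^ (-b)) Filter.atTop (nhds 0) := by
    simpa using ((tendsto_rpow_neg_atTop hb).comp hc).const_mul K
  have h3 : ∀ᶠ n : ℕ in Filter.atTop, 3 * a * Real.log n ≤ (n : ℝ) ^ κ := by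
    have h := ((isLittleO_log_rpow_atTop hκ).const_mul_left (3 * a)).bound one_pos
    filter_upwards [hc.eventually h] with n hn
    rw [one_mul, Real.norm_eq_abs, Real.norm_eq_abs,
      abs_of_nonneg (Real.rpow_nonneg (Nat.cast_nonneg n) κ)] at hn
    exact (le_abs_self _).trans hn
  obtain ⟨N, hN⟩ := Filter.eventually_atTop.1 ((Filter.eventually_ge_atTop 2).and
    ((h1.eventually_ge_atTop 2).and ((h1.eventually_ge_atTop C₀).and
      (h3.and (h2.eventually_le_const (by norm_num : (0 : ℝ) < 1 / 2))))))
  exact ⟨N, hN⟩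

theorem statement14 (a b C₀ : ℝ) (ha : 0 < a) (hb : 0 < b) (hab : a + b < 1 / 2)
    (hC₀ : 0 < C₀) :
    ∃ ε : ℝ, 0 < ε ∧ ∃ C : ℝ, 0 < C ∧ ∃ N : ℕ, ∀ n : ℕ, N ≤ n →
      ∀ d : Fin n → ℕ, (degFinset n d).Nonempty →
        deltaPar n d ≤ C₀ * (n : ℝ) ^ ((1 : ℝ) / 2 + ε) →
        min (dbar n d) ((n : ℝ) - dbar n d - 1) ≥ (n : ℝ) / (3 * a * Real.log n) →
        ∃ E : ℝ, |E| ≤ C * (n : ℝ) ^ (-b) ∧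
          expTrees n d =
            (n : ℝ) ^ (n - 2) * (lam n d) ^ (n - 1) *
              Real.exp (
                -((1 - lam n d) / (2 * lam n d))
                - Rpar n d / (2 * (lam n d) ^ 2 * n)
                + E) := by
  obtain ⟨κ, hκ⟩ : ∃ κ, κ = (1 - 2 * b) / 72 := ⟨_, rfl⟩
  have hκ0 : 0 < κ := by rw [hκ]; linarith
  obtain ⟨N, hN⟩ := eventually_bounds hκ0 hb a C₀ 249314
  refine ⟨κ, hκ0, 498631, by norm_num, N, fun n hNn d hne hδ hmin => ?_⟩
  obtain ⟨hn2, hx2, hCx, hlogx, hsmall⟩ := hN n hNn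
  have hn : 0 < n := by omega
  have hn' : (0 : ℝ) < n := by exact_mod_cast hn
  have hn1 : (1 : ℝ) < n := by exact_mod_cast hn2
  have hxpow : ∀ k : ℕ, ((n : ℝ) ^ κ) ^ k = (n : ℝ) ^ (κ * k) := fun k => by
    rw [Real.rpow_mul hn'.le, Real.rpow_natCast]
  have hmono : ∀ s t : ℝ, s ≤ t → (n : ℝ) ^ s ≤ (n : ℝ) ^ t := fun s t h =>
    Real.rpow_le_rpow_of_exponent_le hn1.le h
  set x := (n : ℝ) ^ κ with hx
  have hx1 : 1 ≤ x := by linarith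
  have hy : ((n : ℝ) ^ ((1 : ℝ) / 2)) ^ 2 = n := by
    rw [← Real.rpow_natCast, ← Real.rpow_mul hn'.le]
    norm_num
  have hxy : x ^ 10 ≤ (n : ℝ) ^ ((1 : ℝ) / 2) := by
    rw [hxpow]
    refine hmono _ _ ?_
    push_cast
    linarith
  have hℓ : 0 < 3 * a * Real.log n := by
    have := Real.log_pos hn1
    positivity
  set ℓ := 3 * a * Real.log n with hℓdef
  set D := dbar n d with hDdef
  have hmin1 : n / ℓ ≤ D := hmin.trans (min_le_left _ _)
  have hmin2 : n / ℓ ≤ n - D - 1 := hmin.trans (min_le_right _ _)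
  have hD : 0 < D := lt_of_lt_of_le (by positivity) hmin1
  have hnD : n ≤ D * ℓ := by rwa [div_le_iff₀ hℓ] at hmin1
  have hnD' : n ≤ (n - D - 1) * ℓ := by rwa [div_le_iff₀ hℓ] at hmin2
  have hρn : D / n * n = D := by field_simp
  have hρ0 : 0 < D / n := by positivity
  have hρ1 : D / n < 1 := by
    rw [div_lt_one hn']
    have : 0 < n / ℓ := by positivity
    linarith
  have hρx : 1 ≤ D / n * x := by
    rw [div_mul_eq_mul_div, le_div_iff₀ hn']
    have := mul_le_mul_of_nonneg_left hlogx hD.le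
    linarith
  have hρx' : 1 ≤ (1 - D / n) * x := by
    have e : (1 - D / n) * x = (n - D) * x / n := by field_simp
    rw [e, le_div_iff₀ hn']
    have h : 0 < n / ℓ := by positivity
    have := mul_le_mul_of_nonneg_left hlogx (by linarith : 0 ≤ n - D - 1)
    linarith
  have hsum : ∑ k, (d k : ℝ) = n * (D / n * n) := by
    rw [hρn, hDdef, dbar]
    field_simp
  have hδd : ∀ u, |(d u : ℝ) - D / n * n| ≤ deltaPar n d := fun u => by
    rw [hρn]
    exact le_ciSup (f := fun j : Fin n => |(d j : ℝ) - dbar n d|) (Set.finite_range _).bddAbove u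
  have hδx : deltaPar n d ≤ (n : ℝ) ^ ((1 : ℝ) / 2) * x ^ 2 := by
    refine hδ.trans ?_
    rw [Real.rpow_add hn', ← hx]
    have := mul_le_mul_of_nonneg_right hCx
      (by positivity : 0 ≤ (n : ℝ) ^ ((1 : ℝ) / 2) * x)
    linarith
  obtain ⟨S, hS⟩ : ∃ S, S = ∑ i, ((d i : ℝ) - D / n * n) ^ 2 := ⟨_, rfl⟩
  have hSn : Rpar n d = S / n := by rw [hS, Rpar, hρn]
  have hθ₀ : 0 < (n : ℝ) ^ (-b) := by positivity
  have key := abs_expTrees_sub_mainTerm_le_of_bounds hn hne hρ0 hρ1 hsum hδd hθ₀ hS hx2 hy hxy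
    hρx hρx' hδx
  have hM := mainTerm_pos hn hρ0 S
  set M := mainTerm n (D / n) S with hMdef
  have hexp : Real.exp (2 + 1 / (2 * (D / n))) ≤ 8 * (n : ℝ) ^ (3 * a / 2) := by
    rw [Real.exp_add]
    refine mul_le_mul ?_ ?_ (Real.exp_pos _).le (by norm_num)
    · have h := Real.exp_one_lt_d9
      have e : Real.exp 2 = Real.exp 1 ^ 2 := by
        rw [← Real.exp_nat_mul]; norm_num
      rw [e]
      have := pow_le_pow_left₀ (Real.exp_pos 1).le h.le 2
      norm_num at this ⊢
      linarith
    · rw [Real.rpow_def_of_pos hn', Real.exp_le_exp]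
      have e : 1 / (2 * (D / n)) = n / D / 2 := by field_simp
      have : n / D ≤ ℓ := by rw [div_le_iff₀ hD]; linarith
      rw [e]
      linarith
  have hinv : (n : ℝ)⁻¹ = (n : ℝ) ^ (-1 : ℝ) := (Real.rpow_neg_one _).symm
  have hb1 : x ^ 18 * (n : ℝ)⁻¹ * (n : ℝ) ^ b ≤ (n : ℝ) ^ (-b) := by
    rw [hxpow, hinv, ← Real.rpow_add hn', ← Real.rpow_add hn']
    refine hmono _ _ ?_
    push_cast
    linarith
  have hb2 : x ^ 18 * (n : ℝ)⁻¹ * (n : ℝ) ^ (3 * a / 2) ≤ (n : ℝ) ^ (-b) := by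
    rw [hxpow, hinv, ← Real.rpow_add hn', ← Real.rpow_add hn']
    refine hmono _ _ ?_
    push_cast
    linarith
  have hrel : |expTrees n d / M - 1| ≤ 249314 * (n : ℝ) ^ (-b) := by
    have e : expTrees n d / M - 1 = (expTrees n d - M) / M := by field_simp
    rw [e, abs_div, abs_of_pos hM, div_le_iff₀ hM]
    refine key.trans ?_
    rw [mul_comm M]
    refine mul_le_mul_of_nonneg_right ?_ hM.le
    have hθinv : 4 * x ^ 6 / (n : ℝ) ^ (-b) = 4 * x ^ 6 * (n : ℝ) ^ b := by
      rw [Real.rpow_neg hn'.le, div_inv_eq_mul]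
    have h1 : 4 * x ^ 6 / (n : ℝ) ^ (-b) + 24 * x ^ 6 * Real.exp (2 + 1 / (2 * (D / n))) ≤
        4 * x ^ 6 * (n : ℝ) ^ b + 24 * x ^ 6 * (8 * (n : ℝ) ^ (3 * a / 2)) := by
      rw [hθinv]
      gcongr
    have h2 := mul_le_mul_of_nonneg_left h1 (by positivity : 0 ≤ 1272 * x ^ 12 / (n : ℝ))
    have h3 : 1272 * x ^ 12 / (n : ℝ) *
        (4 * x ^ 6 * (n : ℝ) ^ b + 24 * x ^ 6 * (8 * (n : ℝ) ^ (3 * a / 2))) =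
        5088 * (x ^ 18 * (n : ℝ)⁻¹ * (n : ℝ) ^ b) +
          244224 * (x ^ 18 * (n : ℝ)⁻¹ * (n : ℝ) ^ (3 * a / 2)) := by
      ring
    linarith
  have hS0 : 0 ≤ S := by rw [hS]; exact Finset.sum_nonneg fun _ _ => sq_nonneg _
  obtain ⟨φ, hφ, hMeq⟩ := mainTerm_eq hn2 hD hS0
  have hφ' : |φ| ≤ 3 * (n : ℝ) ^ (-b) := by
    have hnx : x ^ 6 * (n : ℝ)⁻¹ ≤ (n : ℝ) ^ (-b) := by
      rw [hxpow, hinv, ← Real.rpow_add hn']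
      refine hmono _ _ ?_
      push_cast
      linarith
    have hnDx : n ≤ D * x := hnD.trans (mul_le_mul_of_nonneg_left hlogx hD.le)
    have h1 : 1 / (n : ℝ) ≤ x ^ 6 * (n : ℝ)⁻¹ := by
      rw [one_div]
      exact le_mul_of_one_le_left (by positivity) (one_le_pow₀ hx1)
    have h2 : 1 / D ≤ x ^ 6 * (n : ℝ)⁻¹ := by
      rw [← div_eq_mul_inv, div_le_div_iff₀ hD hn']
      have : D * x ≤ D * x ^ 6 :=
        mul_le_mul_of_nonneg_left (le_self_pow₀ hx1 (by norm_num)) hD.le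
      linarith
    have h3 : S / n / D ^ 2 ≤ x ^ 6 * (n : ℝ)⁻¹ := by
      have hSle : S ≤ n ^ 2 * x ^ 4 := by
        calc S ≤ ∑ _i : Fin n, ((n : ℝ) ^ ((1 : ℝ) / 2) * x ^ 2) ^ 2 := by
              rw [hS]
              refine Finset.sum_le_sum fun i _ => ?_
              rw [← sq_abs]
              exact pow_le_pow_left₀ (abs_nonneg _) ((hδd i).trans hδx) 2
          _ = n ^ 2 * x ^ 4 := by rw [mul_pow, hy]; simp; ring
      rw [← div_eq_mul_inv, div_div, div_le_div_iff₀ (by positivity) hn']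
      calc S * n ≤ n ^ 2 * x ^ 4 * n := by gcongr
        _ ≤ (D * x) ^ 2 * x ^ 4 * n := by gcongr
        _ = _ := by ring
    linarith
  have hlog := abs_log_le_of_abs_sub_one_le (hrel.trans hsmall)
  have hratio : 0 < expTrees n d / M := by
    have := (abs_le.1 (hrel.trans hsmall)).1
    linarith
  refine ⟨Real.log (expTrees n d / M) + φ, ?_, ?_⟩
  · have := abs_add_le (Real.log (expTrees n d / M)) φ
    linarith
  · have hlam : lam n d = D / (n - 1) := rfl
    have e : expTrees n d = M * Real.exp (Real.log (expTrees n d / M)) := by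
      rw [Real.exp_log hratio]
      field_simp
    generalize Real.log (expTrees n d / M) = E at e
    rw [hlam, hSn, e, hMdef, hMeq, mul_assoc, ← Real.exp_add]
    congr 2
    ring

end Stmt14
end
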